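/- Let k and n be positive integers such that 2 ≤ 2k ≤ n < (k+1)^3. Then the polynomial P_{n,k}(x) = ∑_{j=0}^{k} C(n,j) x^j is irreducible over the field ℚ of rational numbers. -/

import Mathlib

open Polynomial

/-- `P n k` is the truncation of the binomial expansion of `(1+x)^n` at the `k`-th stage,
i.e. `∑_{j=0}^{k} C(n,j) x^j`, as a polynomial over `ℚ`. -/
noncomputable def P (n k : ℕ) : Polynomial ℚ :=
  ∑ j ∈ Finset.range (k + 1), Polynomial.C ((n.choose j : ℚ)) * Polynomial.X ^ j


/-- Weighted `p`-adic size of the `j`-th coefficient. -/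
noncomputable def wt (p A : ℕ) (B : ℤ) (g : ℚ[X]) (j : ℕ) : ℚ :=
  (padicNorm p (g.coeff j)) ^ A * (p : ℚ) ^ (B * (j : ℤ))

lemma wt_nonneg (p A : ℕ) (B : ℤ) (g : ℚ[X]) (j : ℕ) : 0 ≤ wt p A B g j := by
  unfold wt
  have := padicNorm.nonneg (p := p) (g.coeff j)
  positivity

lemma wt_pos (p A : ℕ) [hp : Fact p.Prime] (B : ℤ) (g : ℚ[X]) (j : ℕ) (h : g.coeff j ≠ 0) :
    0 < wt p A B g j := by
  unfold wt
  have h1 := padicNorm.nonneg (p := p) (g.coeff j)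
  have h2 := padicNorm.nonzero (p := p) h
  have h3 : 0 < padicNorm p (g.coeff j) := lt_of_le_of_ne h1 (Ne.symm h2)
  have h4 : (0:ℚ) < p := by exact_mod_cast hp.out.pos
  positivity

lemma wt_zero (p A : ℕ) (hA : A ≠ 0) (B : ℤ) (g : ℚ[X]) (j : ℕ) (h : g.coeff j = 0) :
    wt p A B g j = 0 := by
  simp [wt, h, hA]

lemma wt_sum_le (p A : ℕ) [hp : Fact p.Prime] (B : ℤ) (g h : ℚ[X]) (s : ℕ) (M : ℚ) (hM : 0 ≤ M)
    (hA : A ≠ 0) (S : Finset (ℕ × ℕ)) (hS : S ⊆ Finset.HasAntidiagonal.antidiagonal s)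
    (hb : ∀ x ∈ S, wt p A B g x.1 * wt p A B h x.2 ≤ M) :
    (padicNorm p (∑ x ∈ S, g.coeff x.1 * h.coeff x.2)) ^ A * (p : ℚ) ^ (B * (s : ℤ)) ≤ M := by
  have h4 : (0:ℚ) < p := by exact_mod_cast hp.out.pos
  have h5 : (0:ℚ) < (p : ℚ) ^ (B * (s : ℤ)) := by positivity
  rcases S.eq_empty_or_nonempty with rfl | hne
  · simp [hA, hM]
  obtain ⟨x, hx, hmax⟩ := S.exists_max_image (fun x => padicNorm p (g.coeff x.1 * h.coeff x.2)) hne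
  have h1 : padicNorm p (∑ x ∈ S, g.coeff x.1 * h.coeff x.2) ≤
      padicNorm p (g.coeff x.1 * h.coeff x.2) :=
    padicNorm.sum_le hne (fun y hy => hmax y hy)
  refine le_trans ?_ (hb x hx)
  have h2 := Finset.HasAntidiagonal.mem_antidiagonal.1 (hS hx)
  have h3 : wt p A B g x.1 * wt p A B h x.2 =
      (padicNorm p (g.coeff x.1 * h.coeff x.2)) ^ A * (p : ℚ) ^ (B * (s : ℤ)) := by
    unfold wt
    rw [padicNorm.mul, mul_pow, ← h2]
    push_cast
    rw [mul_add, zpow_add₀ h4.ne']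
    ring
  rw [h3]
  have := padicNorm.nonneg (p := p) (∑ x ∈ S, g.coeff x.1 * h.coeff x.2)
  gcongr

/-- General bound for a product. -/
lemma wt_mul_le (p A : ℕ) [hp : Fact p.Prime] (B : ℤ) (g h : ℚ[X]) (s : ℕ) (M : ℚ) (hM : 0 ≤ M)
    (hA : A ≠ 0)
    (hb : ∀ x ∈ Finset.HasAntidiagonal.antidiagonal s, wt p A B g x.1 * wt p A B h x.2 ≤ M) :
    wt p A B (g * h) s ≤ M := by
  have := wt_sum_le p A B g h s M hM hA _ (Finset.Subset.refl _) hb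
  unfold wt
  rwa [Polynomial.coeff_mul]

/-- Strict version. -/
lemma wt_mul_lt (p A : ℕ) [hp : Fact p.Prime] (B : ℤ) (g h : ℚ[X]) (s : ℕ) (M : ℚ) (hM : 0 < M)
    (hA : A ≠ 0)
    (hb : ∀ x ∈ Finset.HasAntidiagonal.antidiagonal s, wt p A B g x.1 * wt p A B h x.2 < M) :
    wt p A B (g * h) s < M := by
  obtain ⟨x, hx, hmax⟩ := (Finset.HasAntidiagonal.antidiagonal s).exists_max_image
    (fun x => wt p A B g x.1 * wt p A B h x.2) ⟨(0, s), by simp⟩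
  exact lt_of_le_of_lt (wt_mul_le p A B g h s _
    (mul_nonneg (wt_nonneg _ _ _ _ _) (wt_nonneg _ _ _ _ _)) hA hmax) (hb x hx)

/-- Equality when one term dominates. -/
lemma wt_mul_eq (p A : ℕ) [hp : Fact p.Prime] (B : ℤ) (g h : ℚ[X]) (a b : ℕ)
    (hA : A ≠ 0) (hpos : 0 < wt p A B g a * wt p A B h b)
    (hb : ∀ x ∈ Finset.HasAntidiagonal.antidiagonal (a + b), x ≠ (a, b) →
      wt p A B g x.1 * wt p A B h x.2 < wt p A B g a * wt p A B h b) :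
    wt p A B (g * h) (a + b) = wt p A B g a * wt p A B h b := by
  have h4 : (0:ℚ) < p := by exact_mod_cast hp.out.pos
  have hmem : (a, b) ∈ Finset.HasAntidiagonal.antidiagonal (a + b) := by simp
  have key : wt p A B g a * wt p A B h b =
      (padicNorm p (g.coeff a * h.coeff b)) ^ A * (p : ℚ) ^ (B * ((a + b : ℕ) : ℤ)) := by
    unfold wt
    rw [padicNorm.mul, mul_pow]
    push_cast
    rw [mul_add, zpow_add₀ h4.ne']
    ring
  set S := (Finset.HasAntidiagonal.antidiagonal (a + b)).erase (a, b) with hS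
  have hlt : padicNorm p (∑ x ∈ S, g.coeff x.1 * h.coeff x.2) <
      padicNorm p (g.coeff a * h.coeff b) := by
    have h5 : (0:ℚ) < (p : ℚ) ^ (B * ((a + b : ℕ) : ℤ)) := by positivity
    have h6 : (padicNorm p (∑ x ∈ S, g.coeff x.1 * h.coeff x.2)) ^ A *
        (p : ℚ) ^ (B * ((a + b : ℕ) : ℤ)) < wt p A B g a * wt p A B h b := by
      rcases S.eq_empty_or_nonempty with he | hne
      · rw [he]; simp [hA, hpos]
      obtain ⟨x, hx, hmax⟩ := S.exists_max_image
        (fun x => wt p A B g x.1 * wt p A B h x.2) hne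
      refine lt_of_le_of_lt (wt_sum_le p A B g h (a + b) _
        (mul_nonneg (wt_nonneg _ _ _ _ _) (wt_nonneg _ _ _ _ _)) hA S (Finset.erase_subset _ _) hmax)
        (hb x (Finset.mem_of_mem_erase hx) (Finset.ne_of_mem_erase hx))
    rw [key] at h6
    have h7 := lt_of_mul_lt_mul_right h6 h5.le
    exact lt_of_pow_lt_pow_left₀ A (padicNorm.nonneg _) h7
  have hsum : (g * h).coeff (a + b) =
      g.coeff a * h.coeff b + ∑ x ∈ S, g.coeff x.1 * h.coeff x.2 := by
    rw [Polynomial.coeff_mul, hS, Finset.add_sum_erase _ (fun x : ℕ × ℕ => g.coeff x.1 * h.coeff x.2) hmem]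
  rw [key]
  unfold wt
  rw [hsum, padicNorm.add_eq_max_of_ne hlt.ne', max_eq_left hlt.le]

lemma exists_max_wt (p A : ℕ) [Fact p.Prime] (B : ℤ) (g : ℚ[X]) (hA : A ≠ 0) (hg : g ≠ 0) :
    ∃ m : ℕ, g.coeff m ≠ 0 ∧ ∀ j, wt p A B g j ≤ wt p A B g m := by
  obtain ⟨m, hm, hmax⟩ := g.support.exists_max_image (wt p A B g)
    (Polynomial.support_nonempty.2 hg)
  refine ⟨m, Polynomial.mem_support_iff.1 hm, fun j => ?_⟩
  by_cases h : g.coeff j = 0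
  · rw [wt_zero p A hA B g j h]; exact wt_nonneg _ _ _ _ _
  · exact hmax j (Polynomial.mem_support_iff.2 h)

def IsFirst (p A : ℕ) (B : ℤ) (g : ℚ[X]) (m : ℕ) : Prop :=
  (∀ j, wt p A B g j ≤ wt p A B g m) ∧ ∀ j, j < m → wt p A B g j < wt p A B g m

def IsLast (p A : ℕ) (B : ℤ) (g : ℚ[X]) (m : ℕ) : Prop :=
  (∀ j, wt p A B g j ≤ wt p A B g m) ∧ ∀ j, m < j → wt p A B g j < wt p A B g m

lemma max_pos (p A : ℕ) [Fact p.Prime] (B : ℤ) (g : ℚ[X]) (hA : A ≠ 0) (hg : g ≠ 0) (m : ℕ)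
    (h : ∀ j, wt p A B g j ≤ wt p A B g m) : 0 < wt p A B g m ∧ g.coeff m ≠ 0 := by
  obtain ⟨m', h1, h2⟩ := exists_max_wt p A B g hA hg
  have h3 := lt_of_lt_of_le (wt_pos p A B g m' h1) (h m')
  refine ⟨h3, fun h0 => ?_⟩
  rw [wt_zero p A hA B g m h0] at h3
  exact lt_irrefl _ h3

lemma exists_first (p A : ℕ) [Fact p.Prime] (B : ℤ) (g : ℚ[X]) (hA : A ≠ 0) (hg : g ≠ 0) :
    ∃ m, IsFirst p A B g m := by
  classical
  obtain ⟨m, _, h2⟩ := exists_max_wt p A B g hA hg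
  have hex : ∃ m, ∀ j, wt p A B g j ≤ wt p A B g m := ⟨m, h2⟩
  refine ⟨Nat.find hex, Nat.find_spec hex, fun j hj => ?_⟩
  have h3 := Nat.find_min hex hj
  push Not at h3
  obtain ⟨i, hi⟩ := h3
  exact lt_of_lt_of_le hi (Nat.find_spec hex i)

lemma exists_last (p A : ℕ) [Fact p.Prime] (B : ℤ) (g : ℚ[X]) (hA : A ≠ 0) (hg : g ≠ 0) :
    ∃ m, IsLast p A B g m := by
  classical
  obtain ⟨m, hm, h2⟩ := exists_max_wt p A B g hA hg
  obtain ⟨r, hr, hmax⟩ := (g.support.filter (fun m => ∀ j, wt p A B g j ≤ wt p A B g m)).exists_max_image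
    id ⟨m, by simp [hm, h2]⟩
  rw [Finset.mem_filter] at hr
  refine ⟨r, hr.2, fun j hj => ?_⟩
  by_contra hcon
  push Not at hcon
  have hj2 : ∀ i, wt p A B g i ≤ wt p A B g j := fun i => (hr.2 i).trans hcon
  have := hmax j (by
    rw [Finset.mem_filter]
    exact ⟨Polynomial.mem_support_iff.2 (max_pos p A B g hA hg j hj2).2, hj2⟩)
  simp only [id] at this
  omega


lemma prod_lt_left {x y a b : ℚ} (hy : y ≤ b) (hx : x < a) (h0 : 0 ≤ x) (hb : 0 < b) :
    x * y < a * b :=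
  lt_of_le_of_lt (mul_le_mul_of_nonneg_left hy h0) (mul_lt_mul_of_pos_right hx hb)

lemma prod_lt_right {x y a b : ℚ} (hx : x ≤ a) (hy : y < b) (h0 : 0 ≤ y) (ha : 0 < a) :
    x * y < a * b := by
  rw [mul_comm x, mul_comm a]
  exact prod_lt_left hx hy h0 ha

lemma first_add (p A : ℕ) [Fact p.Prime] (B : ℤ) (g h : ℚ[X]) (hA : A ≠ 0)
    (hg : g ≠ 0) (hh : h ≠ 0) (a b c : ℕ) (ha : IsFirst p A B g a) (hb : IsFirst p A B h b)
    (hc : IsFirst p A B (g * h) c) : a + b = c := by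
  have pa := (max_pos p A B g hA hg a ha.1).1
  have pb := (max_pos p A B h hA hh b hb.1).1
  have hlt : ∀ x y, x < a ∨ y < b →
      wt p A B g x * wt p A B h y < wt p A B g a * wt p A B h b := by
    rintro x y (h1 | h1)
    · exact prod_lt_left (hb.1 y) (ha.2 x h1) (wt_nonneg _ _ _ _ _) pb
    · exact prod_lt_right (ha.1 x) (hb.2 y h1) (wt_nonneg _ _ _ _ _) pa
  have heq := wt_mul_eq p A B g h a b hA (mul_pos pa pb) (fun x hx hne => by
    have h1 := Finset.HasAntidiagonal.mem_antidiagonal.1 hx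
    apply hlt
    by_contra hcon
    push Not at hcon
    apply hne
    ext <;> simp <;> omega)
  have hsm : ∀ s, s < a + b → wt p A B (g * h) s < wt p A B g a * wt p A B h b := fun s hs =>
    wt_mul_lt p A B g h s _ (mul_pos pa pb) hA (fun x hx => by
      have h1 := Finset.HasAntidiagonal.mem_antidiagonal.1 hx
      apply hlt
      omega)
  rcases lt_trichotomy c (a + b) with h1 | h1 | h1
  · have h2 := hsm c h1
    have h3 := hc.1 (a + b)
    rw [heq] at h3
    exact absurd h2 (not_lt.2 h3)
  · exact h1.symm
  · have h2 := hc.2 _ h1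
    rw [heq] at h2
    have h3 := wt_mul_le p A B g h c _ (mul_pos pa pb).le hA (fun x _ =>
      mul_le_mul (ha.1 x.1) (hb.1 x.2) (wt_nonneg _ _ _ _ _) pa.le)
    exact absurd h2 (not_lt.2 h3)

lemma last_add (p A : ℕ) [Fact p.Prime] (B : ℤ) (g h : ℚ[X]) (hA : A ≠ 0)
    (hg : g ≠ 0) (hh : h ≠ 0) (a b c : ℕ) (ha : IsLast p A B g a) (hb : IsLast p A B h b)
    (hc : IsLast p A B (g * h) c) : a + b = c := by
  have pa := (max_pos p A B g hA hg a ha.1).1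
  have pb := (max_pos p A B h hA hh b hb.1).1
  have hlt : ∀ x y, a < x ∨ b < y →
      wt p A B g x * wt p A B h y < wt p A B g a * wt p A B h b := by
    rintro x y (h1 | h1)
    · exact prod_lt_left (hb.1 y) (ha.2 x h1) (wt_nonneg _ _ _ _ _) pb
    · exact prod_lt_right (ha.1 x) (hb.2 y h1) (wt_nonneg _ _ _ _ _) pa
  have heq := wt_mul_eq p A B g h a b hA (mul_pos pa pb) (fun x hx hne => by
    have h1 := Finset.HasAntidiagonal.mem_antidiagonal.1 hx
    apply hlt
    by_contra hcon
    push Not at hcon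
    apply hne
    ext <;> simp <;> omega)
  have hsm : ∀ s, a + b < s → wt p A B (g * h) s < wt p A B g a * wt p A B h b := fun s hs =>
    wt_mul_lt p A B g h s _ (mul_pos pa pb) hA (fun x hx => by
      have h1 := Finset.HasAntidiagonal.mem_antidiagonal.1 hx
      apply hlt
      omega)
  rcases lt_trichotomy c (a + b) with h1 | h1 | h1
  · have h2 := hc.2 _ h1
    rw [heq] at h2
    have h3 := wt_mul_le p A B g h c _ (mul_pos pa pb).le hA (fun x _ =>
      mul_le_mul (ha.1 x.1) (hb.1 x.2) (wt_nonneg _ _ _ _ _) pa.le)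
    exact absurd h2 (not_lt.2 h3)
  · exact h1.symm
  · have h2 := hsm c h1
    have h3 := hc.1 (a + b)
    rw [heq] at h3
    exact absurd h2 (not_lt.2 h3)

/-- Translation to valuations. -/
lemma wt_eq_zpow (p A : ℕ) [hp : Fact p.Prime] (B : ℤ) (g : ℚ[X]) (j : ℕ) (h : g.coeff j ≠ 0) :
    wt p A B g j = (p : ℚ) ^ (-(A * padicValRat p (g.coeff j)) + B * j) := by
  have h4 : (p:ℚ) ≠ 0 := by exact_mod_cast hp.out.ne_zero
  unfold wt
  rw [padicNorm.eq_zpow_of_nonzero h, zpow_add₀ h4, ← zpow_natCast, ← zpow_mul]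
  congr 2
  ring

lemma wt_le_iff (p A : ℕ) [hp : Fact p.Prime] (B : ℤ) (g : ℚ[X]) (i j : ℕ) (hi : g.coeff i ≠ 0)
    (hj : g.coeff j ≠ 0) : wt p A B g i ≤ wt p A B g j ↔
      -(A * padicValRat p (g.coeff i)) + B * i ≤ -(A * padicValRat p (g.coeff j)) + B * j := by
  rw [wt_eq_zpow p A B g i hi, wt_eq_zpow p A B g j hj]
  exact zpow_le_zpow_iff_right₀ (by exact_mod_cast hp.out.one_lt)

lemma wt_lt_iff (p A : ℕ) [hp : Fact p.Prime] (B : ℤ) (g : ℚ[X]) (i j : ℕ) (hi : g.coeff i ≠ 0)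
    (hj : g.coeff j ≠ 0) : wt p A B g i < wt p A B g j ↔
      -(A * padicValRat p (g.coeff i)) + B * i < -(A * padicValRat p (g.coeff j)) + B * j := by
  rw [wt_eq_zpow p A B g i hi, wt_eq_zpow p A B g j hj]
  exact zpow_lt_zpow_iff_right₀ (by exact_mod_cast hp.out.one_lt)

/-- The Newton polygon constraint: a polynomial of degree `k` whose coefficients all have valuation
`D` except the `l`-th, which has valuation `D - e`. -/
theorem newton_constraint (p : ℕ) [Fact p.Prime] (g h : ℚ[X]) (k l e : ℕ) (D : ℤ) (he : 0 < e)
    (hl : l ≤ k) (hgh : g * h ≠ 0) (hdeg : (g * h).natDegree = k)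
    (hne : ∀ j, j ≤ k → (g * h).coeff j ≠ 0)
    (hD : ∀ j, j ≤ k → j ≠ l → padicValRat p ((g * h).coeff j) = D)
    (hDl : padicValRat p ((g * h).coeff l) = D - e) :
    ∃ i j, i ≤ l ∧ j ≤ k - l ∧ g.natDegree = i + j ∧ l ∣ e * i ∧ (k - l) ∣ e * j := by
  have hg : g ≠ 0 := left_ne_zero_of_mul hgh
  have hh : h ≠ 0 := right_ne_zero_of_mul hgh
  have hdd : g.natDegree + h.natDegree = k := by rw [← hdeg, natDegree_mul hg hh]
  have hbig : ∀ j, k < j → (g * h).coeff j = 0 := fun j hj =>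
    coeff_eq_zero_of_natDegree_lt (by omega)
  have valle : ∀ j, j ≤ k → (j ≠ l ∧ padicValRat p ((g * h).coeff j) = D) ∨
      (j = l ∧ padicValRat p ((g * h).coeff j) = D - e) := by
    intro j hj
    by_cases hjl : j = l
    · right; subst hjl; exact ⟨rfl, hDl⟩
    · left; exact ⟨hjl, hD j hj hjl⟩
  -- left edge
  have left : 0 < l → ∃ i, i ≤ l ∧ i ≤ g.natDegree ∧ l ∣ e * i ∧ IsLast p l (-e) g i ∧
      l - i ≤ h.natDegree ∧ IsLast p l (-e) h (l - i) := by
    intro hl0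
    have hA : l ≠ 0 := by omega
    have cmp : ∀ x y, x ≤ k → y ≤ k → (wt p l (-e) (g * h) x ≤ wt p l (-e) (g * h) y ↔ _) :=
      fun x y hx hy => wt_le_iff p l (-e) (g * h) x y (hne x hx) (hne y hy)
    have cmp' : ∀ x y, x ≤ k → y ≤ k → (wt p l (-e) (g * h) x < wt p l (-e) (g * h) y ↔ _) :=
      fun x y hx hy => wt_lt_iff p l (-e) (g * h) x y (hne x hx) (hne y hy)
    have v0 : padicValRat p ((g * h).coeff 0) = D := hD 0 (by omega) (by omega)
    have he' : (0:ℤ) < e := by exact_mod_cast he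
    have hfirst : IsFirst p l (-e) (g * h) 0 := by
      refine ⟨fun j => ?_, fun j hj => by omega⟩
      by_cases hj : j ≤ k
      · rw [cmp j 0 hj (by omega), v0]
        rcases valle j hj with ⟨h1, h2⟩ | ⟨h1, h2⟩ <;> rw [h2]
        · push_cast; nlinarith
        · subst h1; push_cast; nlinarith
      · rw [wt_zero p l hA _ _ j (hbig j (by omega))]; exact wt_nonneg _ _ _ _ _
    have hlast : IsLast p l (-e) (g * h) l := by
      refine ⟨fun j => ?_, fun j hj => ?_⟩
      · by_cases hj : j ≤ k
        · rw [cmp j l hj hl, hDl]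
          rcases valle j hj with ⟨h1, h2⟩ | ⟨h1, h2⟩ <;> rw [h2]
          · push_cast; nlinarith
          · subst h1; push_cast; nlinarith
        · rw [wt_zero p l hA _ _ j (hbig j (by omega))]; exact wt_nonneg _ _ _ _ _
      · by_cases hj2 : j ≤ k
        · rw [cmp' j l hj2 hl, hDl, hD j hj2 (by omega)]
          have : (0:ℤ) < j := by exact_mod_cast (by omega : 0 < j)
          nlinarith
        · rw [wt_zero p l hA _ _ j (hbig j (by omega))]; exact wt_pos p l _ _ _ (hne l hl)
    obtain ⟨a, ha⟩ := exists_first p l (-e) g hA hg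
    obtain ⟨b, hb⟩ := exists_first p l (-e) h hA hh
    have hab := first_add p l (-e) g h hA hg hh a b 0 ha hb hfirst
    obtain ⟨i, hi⟩ := exists_last p l (-e) g hA hg
    obtain ⟨i', hi'⟩ := exists_last p l (-e) h hA hh
    have hii := last_add p l (-e) g h hA hg hh i i' l hi hi' hlast
    have ha0 : a = 0 := by omega
    subst ha0
    have c0 := (max_pos p l (-e) g hA hg 0 ha.1).2
    have ci := (max_pos p l (-e) g hA hg i hi.1).2
    have ci' := (max_pos p l (-e) h hA hh i' hi'.1).2
    have hli : l - i = i' := by omega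
    refine ⟨i, by omega, le_natDegree_of_ne_zero ci, ?_, hi, ?_, ?_⟩
    · have e1 := (wt_le_iff p l (-e) g 0 i c0 ci).1 (hi.1 0)
      have e2 := (wt_le_iff p l (-e) g i 0 ci c0).1 (ha.1 i)
      have e3 : (e:ℤ) * i = l * (padicValRat p (g.coeff 0) - padicValRat p (g.coeff i)) := by
        push_cast at e1 e2; linarith
      have : (l:ℤ) ∣ (e:ℤ) * i := ⟨_, e3⟩
      exact_mod_cast this
    · rw [hli]; exact le_natDegree_of_ne_zero ci'
    · rw [hli]; exact hi'
  have right : l < k → ∃ i, i ≤ l ∧ i ≤ g.natDegree ∧ (k - l) ∣ e * (g.natDegree - i) ∧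
      IsFirst p (k - l) e g i ∧ l - i ≤ h.natDegree ∧ IsFirst p (k - l) e h (l - i) := by
    intro hl0
    have hA : k - l ≠ 0 := by omega
    have cmp : ∀ x y, x ≤ k → y ≤ k → (wt p (k - l) e (g * h) x ≤ wt p (k - l) e (g * h) y ↔ _) :=
      fun x y hx hy => wt_le_iff p (k - l) e (g * h) x y (hne x hx) (hne y hy)
    have cmp' : ∀ x y, x ≤ k → y ≤ k → (wt p (k - l) e (g * h) x < wt p (k - l) e (g * h) y ↔ _) :=
      fun x y hx hy => wt_lt_iff p (k - l) e (g * h) x y (hne x hx) (hne y hy)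
    have vk : padicValRat p ((g * h).coeff k) = D := hD k le_rfl (by omega)
    have he' : (0:ℤ) < e := by exact_mod_cast he
    have hcast : ((k - l : ℕ) : ℤ) = k - l := by push_cast [hl]; ring
    have hmaxle : ∀ j, wt p (k - l) e (g * h) j ≤ wt p (k - l) e (g * h) k := by
      intro j
      by_cases hj : j ≤ k
      · have hj' : (j:ℤ) ≤ k := by exact_mod_cast hj
        rw [cmp j k hj le_rfl, vk]
        rcases valle j hj with ⟨h1, h2⟩ | ⟨h1, h2⟩ <;> rw [h2, hcast]
        · nlinarith
        · subst h1; nlinarith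
      · rw [wt_zero p (k - l) hA _ _ j (hbig j (by omega))]; exact wt_nonneg _ _ _ _ _
    have hlast : IsLast p (k - l) e (g * h) k := by
      refine ⟨hmaxle, fun j hj => ?_⟩
      rw [wt_zero p (k - l) hA _ _ j (hbig j (by omega))]
      exact wt_pos p (k - l) _ _ _ (hne k le_rfl)
    have hkl : wt p (k - l) e (g * h) k ≤ wt p (k - l) e (g * h) l := by
      rw [cmp k l le_rfl hl, vk, hDl, hcast]
      nlinarith
    have hfirst : IsFirst p (k - l) e (g * h) l := by
      refine ⟨fun j => (hmaxle j).trans hkl, fun j hj => lt_of_lt_of_le ?_ hkl⟩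
      have hj2 : j ≤ k := by omega
      rw [cmp' j k hj2 le_rfl, vk, hD j hj2 (by omega)]
      have : (j:ℤ) < k := by exact_mod_cast (by omega : j < k)
      nlinarith
    obtain ⟨a, ha⟩ := exists_last p (k - l) e g hA hg
    obtain ⟨b, hb⟩ := exists_last p (k - l) e h hA hh
    have hab := last_add p (k - l) e g h hA hg hh a b k ha hb hlast
    obtain ⟨i, hi⟩ := exists_first p (k - l) e g hA hg
    obtain ⟨i', hi'⟩ := exists_first p (k - l) e h hA hh
    have hii := first_add p (k - l) e g h hA hg hh i i' l hi hi' hfirst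
    have ca := (max_pos p (k - l) e g hA hg a ha.1).2
    have cb := (max_pos p (k - l) e h hA hh b hb.1).2
    have ci := (max_pos p (k - l) e g hA hg i hi.1).2
    have ci' := (max_pos p (k - l) e h hA hh i' hi'.1).2
    have la := le_natDegree_of_ne_zero ca
    have lb := le_natDegree_of_ne_zero cb
    have li := le_natDegree_of_ne_zero ci
    have haa : a = g.natDegree := by omega
    have hli : l - i = i' := by omega
    refine ⟨i, by omega, li, ?_, hi, ?_, ?_⟩
    · have e1 := (wt_le_iff p (k - l) e g a i ca ci).1 (hi.1 a)
      have e2 := (wt_le_iff p (k - l) e g i a ci ca).1 (ha.1 i)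
      rw [← haa]
      rw [← haa] at li
      have e3 : (e:ℤ) * ((a - i : ℕ) : ℤ) =
          ((k - l : ℕ) : ℤ) * (padicValRat p (g.coeff a) - padicValRat p (g.coeff i)) := by
        rw [Nat.cast_sub li]; linarith
      have : ((k - l : ℕ) : ℤ) ∣ (e:ℤ) * ((a - i : ℕ) : ℤ) := ⟨_, e3⟩
      exact_mod_cast this
    · rw [hli]; exact le_natDegree_of_ne_zero ci'
    · rw [hli]; exact hi'
  rcases Nat.eq_zero_or_pos l with h0 | h0
  · subst h0
    rcases Nat.eq_zero_or_pos k with hk0 | hk0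
    · subst hk0; exact ⟨0, 0, by simp, by simp, by omega, by simp, by simp⟩
    · obtain ⟨i, h1, h2, h3, -⟩ := right hk0
      have : i = 0 := by omega
      subst this
      exact ⟨0, g.natDegree, le_rfl, by omega, by omega, by simp, by simpa using h3⟩
  rcases Nat.lt_or_ge l k with h1 | h1
  · obtain ⟨i, a1, a2, a3, a4, a5, a6⟩ := left h0
    obtain ⟨j, b1, b2, b3, b4, b5, b6⟩ := right h1
    have conv : ∀ (q : ℚ[X]) (x y : ℕ), q ≠ 0 → IsLast p l (-e) q x → IsFirst p (k - l) e q y →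
        x ≤ y := by
      intro q x y hq hx hy
      by_contra hcon
      push Not at hcon
      have cx := (max_pos p l (-e) q (by omega) hq x hx.1).2
      have cy := (max_pos p (k - l) e q (by omega) hq y hy.1).2
      have e1 := (wt_le_iff p l (-e) q y x cy cx).1 (hx.1 y)
      have e2 := (wt_le_iff p (k - l) e q x y cx cy).1 (hy.1 x)
      have hxy : (y:ℤ) < x := by exact_mod_cast hcon
      have he' : (0:ℤ) < e := by exact_mod_cast he
      have hl' : (0:ℤ) < l := by exact_mod_cast h0
      have hkl' : (0:ℤ) < ((k - l : ℕ) : ℤ) := by exact_mod_cast (by omega : 0 < k - l)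
      have m1 : 0 < (e:ℤ) * (x - y) := mul_pos he' (by linarith)
      have m2 : 0 < (l:ℤ) * (padicValRat p (q.coeff y) - padicValRat p (q.coeff x)) := by nlinarith
      have m3 : 0 < ((k - l : ℕ) : ℤ) * (padicValRat p (q.coeff x) - padicValRat p (q.coeff y)) := by
        nlinarith
      have m4 := (mul_pos_iff_of_pos_left hl').1 m2
      have m5 := (mul_pos_iff_of_pos_left hkl').1 m3
      linarith
    have c1 := conv g i j hg a4 b4
    have c2 := conv h (l - i) (l - j) hh a6 b6
    have : i = j := by omega
    subst this
    exact ⟨i, g.natDegree - i, a1, by omega, by omega, a3, b3⟩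
  · have : l = k := by omega
    subst this
    obtain ⟨i, a1, a2, a3, a4, a5, a6⟩ := left h0
    have : i = g.natDegree := by omega
    subst this
    exact ⟨g.natDegree, 0, a1, by omega, by omega, a3, by simp⟩


/-- Integer version of `P`. -/
noncomputable def PZ (n k : ℕ) : Polynomial ℤ :=
  ∑ j ∈ Finset.range (k + 1), Polynomial.C ((n.choose j : ℤ)) * Polynomial.X ^ j

lemma PZ_map (n k : ℕ) : (PZ n k).map (Int.castRingHom ℚ) = P n k := by
  simp [PZ, P, Polynomial.map_sum]

lemma PZ_coeff (n k j : ℕ) : (PZ n k).coeff j = if j ≤ k then (n.choose j : ℤ) else 0 := by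
  simp only [PZ, finsetSum_coeff, coeff_C_mul_X_pow]
  by_cases h : j ≤ k
  · rw [Finset.sum_eq_single j]
    · simp [h]
    · intro b _ hb
      simp [Ne.symm hb]
    · intro hj
      exact absurd (Finset.mem_range.2 (by omega)) hj
  · rw [if_neg h]
    apply Finset.sum_eq_zero
    intro b hb
    have := Finset.mem_range.1 hb
    rw [if_neg (by omega)]

lemma PZ_natDegree (n k : ℕ) (h : k ≤ n) : (PZ n k).natDegree = k := by
  apply le_antisymm
  · rw [natDegree_le_iff_coeff_eq_zero]
    intro N hN
    rw [PZ_coeff, if_neg (by omega)]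
  · apply le_natDegree_of_ne_zero
    rw [PZ_coeff, if_pos le_rfl]
    exact_mod_cast (Nat.choose_pos h).ne'

lemma PZ_unit_of_C_dvd (n k : ℕ) (r : ℤ) (h : C r ∣ PZ n k) : IsUnit r := by
  have := (C_dvd_iff_dvd_coeff r _).1 h 0
  rw [PZ_coeff] at this
  simp only [Nat.zero_le, if_true, Nat.choose_zero_right, Nat.cast_one] at this
  exact isUnit_of_dvd_one this

lemma exists_factor (n k : ℕ) (hk : 1 ≤ k) (hkn : k ≤ n) (hred : ¬ Irreducible (P n k)) :
    ∃ g h : ℤ[X], g * h = PZ n k ∧ 1 ≤ g.natDegree ∧ 2 * g.natDegree ≤ k := by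
  have hprim : (PZ n k).IsPrimitive := fun r hr => PZ_unit_of_C_dvd n k r hr
  rw [← PZ_map, ← Polynomial.IsPrimitive.Int.irreducible_iff_irreducible_map_cast hprim] at hred
  have hdeg := PZ_natDegree n k hkn
  have hnu : ¬ IsUnit (PZ n k) := by
    intro hu
    have := natDegree_eq_zero_of_isUnit hu
    omega
  rw [irreducible_iff] at hred
  push Not at hred
  obtain ⟨a, b, hab, ha, hb⟩ := hred hnu
  have h0 : PZ n k ≠ 0 := by
    intro h
    rw [h] at hdeg
    simp at hdeg
    omega
  have key : ∀ a b : ℤ[X], PZ n k = a * b → ¬ IsUnit a → 1 ≤ a.natDegree := by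
    intro a b hab ha
    by_contra hcon
    have h1 : a.natDegree = 0 := by omega
    rw [natDegree_eq_zero] at h1
    obtain ⟨r, rfl⟩ := h1
    exact ha ((PZ_unit_of_C_dvd n k r ⟨b, hab⟩).map C)
  have ka := key a b hab ha
  have kb := key b a (by rw [hab, mul_comm]) hb
  have hs : a.natDegree + b.natDegree = k := by
    rw [← hdeg, hab, natDegree_mul]
    · rintro rfl; simp at ka
    · rintro rfl; simp at kb
  rcases le_total a.natDegree b.natDegree with h | h
  · exact ⟨a, b, hab.symm, ka, by omega⟩
  · exact ⟨b, a, by rw [hab, mul_comm], kb, by omega⟩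

lemma taylor_coeff_PZ (n k j : ℕ) (hkn : k < n) (hj : j ≤ k) :
    (taylor (-1 : ℤ) (PZ n k)).coeff j =
      (-1) ^ (k - j) * (n.choose j : ℤ) * ((n - j - 1).choose (k - j) : ℤ) := by
  have h1 : (taylor (-1 : ℤ) (PZ n k)).coeff j =
      ∑ i ∈ Finset.range (k + 1), (n.choose i : ℤ) * ((-1) ^ (i - j) * (i.choose j : ℤ)) := by
    simp only [PZ, map_sum, finsetSum_coeff]
    apply Finset.sum_congr rfl
    intro i _
    rw [taylor_apply, mul_comp, C_comp, X_pow_comp, coeff_C_mul, coeff_X_add_C_pow]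
  rw [h1, show k + 1 = j + (k - j + 1) by omega, Finset.sum_range_add]
  rw [Finset.sum_eq_zero, zero_add]
  · have h2 := Int.alternating_sum_range_choose_eq_choose (n := n - j - 1) (m := k - j)
    rw [show n - j - 1 + 1 = n - j by omega] at h2
    have h3 : ∀ t ∈ Finset.range (k - j + 1),
        (n.choose (j + t) : ℤ) * ((-1) ^ (j + t - j) * ((j + t).choose j : ℤ)) =
        (n.choose j : ℤ) * ((-1) ^ t * ((n - j).choose t : ℤ)) := by
      intro t ht
      have := Finset.mem_range.1 ht
      have h4 := Nat.choose_mul (n := n) (k := j + t) (s := j) (by omega)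
      rw [show j + t - j = t by omega] at h4 ⊢
      have h5 : (n.choose (j + t) : ℤ) * ((j + t).choose j : ℤ) =
        (n.choose j : ℤ) * ((n - j).choose t : ℤ) := by exact_mod_cast h4
      linear_combination (-1) ^ t * h5
    rw [Finset.sum_congr rfl h3, ← Finset.mul_sum, h2]
    ring
  · intro i hi
    rw [Nat.choose_eq_zero_of_lt (Finset.mem_range.1 hi)]
    simp

lemma choose_identity (n k j : ℕ) (hkn : k < n) (hj : j ≤ k) :
    n.choose j * (n - j - 1).choose (k - j) * (n - j) * j.factorial * (k - j).factorial *
      (n - k - 1).factorial = n.factorial := by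
  have h1 := Nat.choose_mul_factorial_mul_factorial (n := n) (k := j) (by omega)
  have h2 := Nat.choose_mul_factorial_mul_factorial (n := n - j - 1) (k := k - j) (by omega)
  rw [show n - j - 1 - (k - j) = n - k - 1 by omega] at h2
  have h3 : (n - j).factorial = (n - j) * (n - j - 1).factorial := by
    conv_lhs => rw [show n - j = (n - j - 1) + 1 by omega, Nat.factorial_succ]
    rw [show n - j - 1 + 1 = n - j by omega]
  rw [← h1, h3, ← h2]
  ring

lemma prime_constraint (n k l e p : ℕ) (hp : p.Prime) (hkn : k < n) (hpk : k < p) (hl : l ≤ k)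
    (he : 0 < e) (h1 : p ^ e ∣ n - l) (h2 : ¬ p ^ (e + 1) ∣ n - l)
    (g h : ℤ[X]) (hgh : g * h = PZ n k) :
    ∃ i j, i ≤ l ∧ j ≤ k - l ∧ g.natDegree = i + j ∧ l ∣ e * i ∧ (k - l) ∣ e * j := by
  haveI : Fact p.Prime := ⟨hp⟩
  set φ := Int.castRingHom ℚ
  have hinj : Function.Injective φ := Int.cast_injective
  set G := (taylor (-1) g).map φ
  set H := (taylor (-1) h).map φ
  have hGH : G * H = (taylor (-1) (PZ n k)).map φ := by
    rw [← hgh, taylor_mul, Polynomial.map_mul]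
  have hGd : G.natDegree = g.natDegree := by
    rw [natDegree_map_eq_of_injective hinj, natDegree_taylor]
  have hc : ∀ j ≤ k, (G * H).coeff j = (-1) ^ (k - j) *
      ((n.choose j * (n - j - 1).choose (k - j) : ℕ) : ℚ) := by
    intro j hj
    rw [hGH, coeff_map, taylor_coeff_PZ n k j hkn hj]
    simp [φ]
    ring
  have hpos : ∀ j ≤ k, 0 < n.choose j * (n - j - 1).choose (k - j) := fun j hj =>
    Nat.mul_pos (Nat.choose_pos (by omega)) (Nat.choose_pos (by omega))
  have hdeg : (G * H).natDegree = k := by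
    rw [hGH, natDegree_map_eq_of_injective hinj, natDegree_taylor, PZ_natDegree n k hkn.le]
  have hne : ∀ j ≤ k, (G * H).coeff j ≠ 0 := by
    intro j hj
    rw [hc j hj]
    apply mul_ne_zero
    · exact pow_ne_zero _ (by norm_num)
    · exact_mod_cast (hpos j hj).ne'
  have hGH0 : G * H ≠ 0 := by
    intro h0
    apply hne 0 (Nat.zero_le _)
    rw [h0]; simp
  have hv : ∀ j ≤ k, padicValRat p ((G * H).coeff j) =
      (padicValNat p n.factorial : ℤ) - padicValNat p (n - k - 1).factorial
        - padicValNat p (n - j) := by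
    intro j hj
    have e1 : padicValRat p ((G * H).coeff j) =
        padicValNat p (n.choose j * (n - j - 1).choose (k - j)) := by
      rw [hc j hj, ← padicValRat.of_nat]
      rcases neg_one_pow_eq_or ℚ (k - j) with h | h <;> rw [h]
      · rw [one_mul]
      · rw [neg_one_mul, padicValRat.neg]
    have id := choose_identity n k j hkn hj
    have q := hpos j hj
    have e2 : padicValNat p n.factorial =
        padicValNat p (n.choose j * (n - j - 1).choose (k - j)) + padicValNat p (n - j)
        + padicValNat p (n - k - 1).factorial := by
      rw [← id, padicValNat.mul, padicValNat.mul, padicValNat.mul, padicValNat.mul]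
      · rw [padicValNat.eq_zero_of_not_dvd (n := j.factorial),
          padicValNat.eq_zero_of_not_dvd (n := (k - j).factorial)]
        · ring
        · rw [hp.dvd_factorial]; omega
        · rw [hp.dvd_factorial]; omega
      all_goals first | positivity | skip
      all_goals have := q.ne'
      all_goals have q2 : n - j ≠ 0 := by omega
      all_goals have q3 := j.factorial_ne_zero
      all_goals have q4 := (k - j).factorial_ne_zero
      all_goals simp_all
    rw [e1, e2]
    push_cast
    ring
  have hpl : p ∣ n - l := (dvd_pow_self p he.ne').trans h1
  have hvl : padicValNat p (n - l) = e := by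
    have a1 := (padicValNat_dvd_iff_le (p := p) (a := n - l) (n := e) (by omega)).1 h1
    have a2 := mt (padicValNat_dvd_iff_le (p := p) (a := n - l) (n := e + 1) (by omega)).2 h2
    omega
  have hvj : ∀ j ≤ k, j ≠ l → padicValNat p (n - j) = 0 := by
    intro j hj hjl
    apply padicValNat.eq_zero_of_not_dvd
    intro hd
    rcases lt_or_gt_of_ne hjl with h | h
    · have := Nat.le_of_dvd (by omega) (Nat.dvd_sub hd hpl)
      omega
    · have := Nat.le_of_dvd (by omega) (Nat.dvd_sub hpl hd)
      omega
  have := newton_constraint p G H k l e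
    ((padicValNat p n.factorial : ℤ) - padicValNat p (n - k - 1).factorial) he hl hGH0 hdeg hne
    (by intro j hj hjl; rw [hv j hj, hvj j hj hjl]; simp) (by rw [hv l hl, hvl])
  rwa [hGd] at this

/-- `n - l` has a prime factor exceeding `k` to the first power. -/
def Good (n k l : ℕ) : Prop := ∃ p, p.Prime ∧ k < p ∧ p ∣ n - l ∧ ¬ p ^ 2 ∣ n - l

/-- `n - l` has a prime factor exceeding `k`. -/
def NS (n k l : ℕ) : Prop := ∃ p, p.Prime ∧ k < p ∧ p ∣ n - l

lemma good_constraint (n k l : ℕ) (hkn : k < n) (hl : l ≤ k) (hg : Good n k l)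
    (g h : ℤ[X]) (hgh : g * h = PZ n k) (hd1 : 1 ≤ g.natDegree) (hd2 : 2 * g.natDegree ≤ k) :
    g.natDegree = l ∨ g.natDegree = k - l := by
  obtain ⟨p, hp, hpk, h1, h2⟩ := hg
  obtain ⟨i, j, hi, hj, hij, a, b⟩ := prime_constraint n k l 1 p hp hkn hpk hl (by norm_num)
    (by simpa using h1) (by simpa using h2) g h hgh
  rw [one_mul] at a b
  have ha : i = 0 ∨ i = l := by
    obtain ⟨c, rfl⟩ := a
    rcases Nat.eq_zero_or_pos c with h | h
    · left; simp [h]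
    · right; exact le_antisymm hi (Nat.le_mul_of_pos_right _ h)
  have hb : j = 0 ∨ j = k - l := by
    obtain ⟨c, rfl⟩ := b
    rcases Nat.eq_zero_or_pos c with h | h
    · left; simp [h]
    · right; exact le_antisymm hj (Nat.le_mul_of_pos_right _ h)
  omega

lemma half_cases (i l : ℕ) (hi : i ≤ l) (h : l ∣ 2 * i) : i = 0 ∨ i = l ∨ 2 * i = l := by
  obtain ⟨c, hc⟩ := h
  rcases Nat.eq_zero_or_pos l with h0 | h0
  · omega
  have : c ≤ 2 := by
    by_contra h3
    have : l * 3 ≤ l * c := Nat.mul_le_mul_left _ (by omega)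
    omega
  interval_cases c <;> omega

lemma ns_constraint (n k l : ℕ) (hkn : k < n) (hn3 : n < (k + 1) ^ 3) (hl : l ≤ k)
    (hg : NS n k l)
    (g h : ℤ[X]) (hgh : g * h = PZ n k) (hd1 : 1 ≤ g.natDegree) (hd2 : 2 * g.natDegree ≤ k) :
    g.natDegree = l ∨ g.natDegree = k - l ∨ 2 * g.natDegree = l ∨ 2 * g.natDegree = k - l ∨
      (2 * g.natDegree = k ∧ l % 2 = 0) := by
  by_cases hgood : Good n k l
  · have := good_constraint n k l hkn hl hgood g h hgh hd1 hd2
    tauto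
  obtain ⟨p, hp, hpk, h1⟩ := hg
  have h2 : p ^ 2 ∣ n - l := by
    by_contra h
    exact hgood ⟨p, hp, hpk, h1, h⟩
  have h3 : ¬ p ^ 3 ∣ n - l := by
    intro h
    have a := Nat.le_of_dvd (by omega) h
    have b := Nat.pow_le_pow_left (show k + 1 ≤ p by omega) 3
    omega
  obtain ⟨i, j, hi, hj, hij, a, b⟩ := prime_constraint n k l 2 p hp hkn hpk hl (by norm_num)
    h2 h3 g h hgh
  have := half_cases i l hi a
  have := half_cases j (k - l) hj b
  omega

lemma good_of_ns (n k l : ℕ) (hkn : k < n) (hn2 : n < (k + 1) ^ 2) (hl : l ≤ k)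
    (hg : NS n k l) : Good n k l := by
  obtain ⟨p, hp, hpk, h1⟩ := hg
  refine ⟨p, hp, hpk, h1, ?_⟩
  intro h
  have a := Nat.le_of_dvd (by omega) h
  have b := Nat.pow_le_pow_left (show k + 1 ≤ p by omega) 2
  omega

/-- Two good indices which are not complementary suffice. -/
lemma irr_of_two_good (n k : ℕ) (hk : 1 ≤ k) (hkn : k < n) (l₁ l₂ : ℕ) (h1 : l₁ ≤ k) (h2 : l₂ ≤ k)
    (hne : l₁ ≠ l₂) (hs : l₁ + l₂ ≠ k) (g1 : Good n k l₁) (g2 : Good n k l₂) :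
    Irreducible (P n k) := by
  by_contra hred
  obtain ⟨g, h, hgh, d1, d2⟩ := exists_factor n k hk hkn.le hred
  have a := good_constraint n k l₁ hkn h1 g1 g h hgh d1 d2
  have b := good_constraint n k l₂ hkn h2 g2 g h hgh d1 d2
  omega

lemma irr_of_good_end (n k : ℕ) (hk : 1 ≤ k) (hkn : k < n) (l : ℕ) (hl : l = 0 ∨ l = k)
    (g1 : Good n k l) : Irreducible (P n k) := by
  by_contra hred
  obtain ⟨g, h, hgh, d1, d2⟩ := exists_factor n k hk hkn.le hred
  have a := good_constraint n k l hkn (by omega) g1 g h hgh d1 d2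
  omega

lemma irr_of_three_good (n k : ℕ) (hk : 1 ≤ k) (hkn : k < n) (l₁ l₂ l₃ : ℕ) (h1 : l₁ < l₂)
    (h2 : l₂ < l₃) (h3 : l₃ ≤ k) (g1 : Good n k l₁) (g2 : Good n k l₂) (g3 : Good n k l₃) :
    Irreducible (P n k) := by
  by_cases h : l₁ + l₂ = k
  · exact irr_of_two_good n k hk hkn l₁ l₃ (by omega) (by omega) (by omega) (by omega) g1 g3
  · exact irr_of_two_good n k hk hkn l₁ l₂ (by omega) (by omega) (by omega) (by omega) g1 g2

open Classical in
/-- the set of nonsmooth indices -/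
noncomputable def nsSet (n k : ℕ) : Finset ℕ := (Finset.range (k + 1)).filter (NS n k)

lemma mem_nsSet {n k l : ℕ} : l ∈ nsSet n k ↔ l ≤ k ∧ NS n k l := by
  simp [nsSet, Nat.lt_succ_iff]

lemma irr_of_card_three (n k : ℕ) (hk : 1 ≤ k) (hkn : k < n) (hn2 : n < (k + 1) ^ 2)
    (hc : 3 ≤ (nsSet n k).card) : Irreducible (P n k) := by
  by_contra hred
  obtain ⟨g, h, hgh, d1, d2⟩ := exists_factor n k hk hkn.le hred
  have hsub : nsSet n k ⊆ {g.natDegree, k - g.natDegree} := by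
    intro l hl
    rw [mem_nsSet] at hl
    have := good_constraint n k l hkn hl.1 (good_of_ns n k l hkn hn2 hl.1 hl.2) g h hgh d1 d2
    simp only [Finset.mem_insert, Finset.mem_singleton]
    omega
  have := Finset.card_le_card hsub
  have := Finset.card_le_two (a := g.natDegree) (b := k - g.natDegree)
  omega

lemma irr_of_card_five (n k : ℕ) (hk : 1 ≤ k) (hkn : k < n) (hn3 : n < (k + 1) ^ 3)
    (hc : 5 ≤ (nsSet n k).card)
    (hodd : k % 2 = 0 → 2 ≤ ((nsSet n k).filter (fun l => l % 2 = 1)).card) :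
    Irreducible (P n k) := by
  by_contra hred
  obtain ⟨g, h, hgh, d1, d2⟩ := exists_factor n k hk hkn.le hred
  have key : ∀ l ∈ nsSet n k, _ := fun l hl => ns_constraint n k l hkn hn3 (mem_nsSet.1 hl).1
    (mem_nsSet.1 hl).2 g h hgh d1 d2
  by_cases hd : 2 * g.natDegree = k
  · have hsub : (nsSet n k).filter (fun l => l % 2 = 1) ⊆ {g.natDegree} := by
      intro l hl
      rw [Finset.mem_filter] at hl
      have := key l hl.1
      have := (mem_nsSet.1 hl.1).1
      simp only [Finset.mem_singleton]
      omega
    have := Finset.card_le_card hsub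
    rw [Finset.card_singleton] at this
    have := hodd (by omega)
    omega
  · have hsub : nsSet n k ⊆ {g.natDegree, k - g.natDegree, 2 * g.natDegree, k - 2 * g.natDegree} := by
      intro l hl
      have := key l hl
      have := (mem_nsSet.1 hl).1
      simp only [Finset.mem_insert, Finset.mem_singleton]
      omega
    have := Finset.card_le_card hsub
    have := Finset.card_le_four (a := g.natDegree) (b := k - g.natDegree) (c := 2 * g.natDegree)
      (d := k - 2 * g.natDegree)
    omega


/-- natural number distance -/
def dst (a b : ℕ) : ℕ := (a - b) + (b - a)

lemma prod_dst (m a : ℕ) (ha : a < m) :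
    ∏ b ∈ (Finset.range m).erase a, dst b a = a.factorial * (m - 1 - a).factorial := by
  have h1 : (Finset.range m).erase a = Finset.range a ∪ Finset.Ico (a + 1) m := by
    ext x
    simp only [Finset.mem_erase, Finset.mem_range, Finset.mem_union, Finset.mem_Ico]
    omega
  rw [h1, Finset.prod_union]
  · congr 1
    · rw [← Finset.prod_range_add_one_eq_factorial, ← Finset.prod_range_reflect]
      apply Finset.prod_congr rfl
      intro x hx
      have := Finset.mem_range.1 hx
      unfold dst; omega
    · rw [Finset.prod_Ico_eq_prod_range, ← Finset.prod_range_add_one_eq_factorial,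
        show m - (a + 1) = m - 1 - a by omega]
      apply Finset.prod_congr rfl
      intro x hx
      unfold dst; omega
  · rw [Finset.disjoint_left]
    intro x hx hx2
    simp at hx hx2
    omega

lemma erdos_count (m s k B : ℕ) (f : ℕ → ℕ) (hs : 0 < s) (hB : 0 < B)
    (hf : ∀ a < m, B ≤ f a)
    (hd : ∀ a < m, ∀ b < m, dst (f a) (f b) = s * dst a b)
    (T : Finset ℕ) (hT : T ⊆ Finset.range m)
    (hsm : ∀ a ∈ T, ∀ p, p.Prime → p ∣ f a → p ≤ k) :
    B ^ (T.card - Nat.primeCounting k) ≤ s ^ (m - 1) * (m - 1).factorial := by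
  have hDpos : 0 < s ^ (m - 1) * (m - 1).factorial := by positivity
  rcases T.eq_empty_or_nonempty with h0 | h0
  · subst h0
    simp only [Finset.card_empty, Nat.zero_sub, pow_zero]; exact hDpos
  have hfpos : ∀ a < m, f a ≠ 0 := fun a ha => by have := hf a ha; omega
  have hmem : ∀ a ∈ T, a < m := fun a ha => Finset.mem_range.1 (hT ha)
  choose L hLT hLmax using fun p : ℕ => Finset.exists_max_image T (fun a => (f a).factorization p) h0
  set Pr := (Finset.range (k + 1)).filter Nat.Prime
  have hPr : Pr.card = Nat.primeCounting k := by
    rw [Nat.primeCounting, Nat.primeCounting', Nat.count_eq_card_filter_range]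
  set R := T \ Pr.image L
  have hRT : R ⊆ T := Finset.sdiff_subset
  have hRcard : T.card - Nat.primeCounting k ≤ R.card := by
    have h1 := Finset.le_card_sdiff (Pr.image L) T
    have h2 : (Pr.image L).card ≤ Pr.card := Finset.card_image_le
    rw [← hPr]
    show _ ≤ (T \ Pr.image L).card
    omega
  have hprod0 : ∏ a ∈ R, f a ≠ 0 := Finset.prod_ne_zero_iff.2 fun a ha => hfpos a (hmem a (hRT ha))
  have hdvd : ∏ a ∈ R, f a ∣ s ^ (m - 1) * (m - 1).factorial := by
    rw [← Nat.factorization_prime_le_iff_dvd hprod0 hDpos.ne']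
    intro p hp
    rw [Nat.factorization_prod fun a ha => hfpos a (hmem a (hRT ha)), Finsupp.finsetSum_apply]
    by_cases hpk : p ≤ k
    · have hLR : L p ∉ R := by
        intro h
        have := (Finset.mem_sdiff.1 h).2
        exact this (Finset.mem_image_of_mem L (Finset.mem_filter.2
          ⟨Finset.mem_range.2 (by omega), hp⟩))
      have hsub : R ⊆ (Finset.range m).erase (L p) := by
        intro a ha
        refine Finset.mem_erase.2 ⟨?_, hT (hRT ha)⟩
        rintro rfl
        exact hLR ha
      have hu := hmem _ (hLT p)
      have hdne : ∀ a ∈ (Finset.range m).erase (L p), s * dst a (L p) ≠ 0 := by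
        intro a ha
        have := Finset.mem_erase.1 ha
        have h2 : dst a (L p) ≠ 0 := by unfold dst; omega
        positivity
      calc ∑ a ∈ R, (f a).factorization p
          ≤ ∑ a ∈ R, (s * dst a (L p)).factorization p := by
            apply Finset.sum_le_sum
            intro a ha
            have ham := hmem a (hRT ha)
            have h1 := hLmax p a (hRT ha)
            rw [← hp.pow_dvd_iff_le_factorization (hdne a (hsub ha)), ← hd a ham _ hu]
            have d1 : p ^ (f a).factorization p ∣ f a := Nat.ordProj_dvd _ _
            have d2 : p ^ (f a).factorization p ∣ f (L p) :=
              (pow_dvd_pow p h1).trans (Nat.ordProj_dvd _ _)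
            unfold dst
            exact dvd_add (Nat.dvd_sub d1 d2) (Nat.dvd_sub d2 d1)
        _ ≤ ∑ a ∈ (Finset.range m).erase (L p), (s * dst a (L p)).factorization p :=
            Finset.sum_le_sum_of_subset hsub
        _ = (∏ a ∈ (Finset.range m).erase (L p), (s * dst a (L p))).factorization p := by
            rw [Nat.factorization_prod hdne, Finsupp.finsetSum_apply]
        _ ≤ (s ^ (m - 1) * (m - 1).factorial).factorization p := by
            apply (Nat.factorization_le_iff_dvd (Finset.prod_ne_zero_iff.2 hdne) hDpos.ne').2
            rw [Finset.prod_mul_distrib, Finset.prod_const, Finset.card_erase_of_mem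
              (Finset.mem_range.2 hu), Finset.card_range, prod_dst m _ hu]
            apply mul_dvd_mul_left
            have := Nat.factorial_mul_factorial_dvd_factorial (n := m - 1) (k := L p) (by omega)
            exact this
    · rw [Finset.sum_eq_zero]
      · exact Nat.zero_le _
      · intro a ha
        apply Nat.factorization_eq_zero_of_not_dvd
        intro h
        exact hpk (hsm a (hRT ha) p hp h)
  calc B ^ (T.card - Nat.primeCounting k) ≤ B ^ R.card := Nat.pow_le_pow_right hB hRcard
    _ ≤ ∏ a ∈ R, f a := Finset.pow_card_le_prod R f B (fun a ha => hf a (hmem a (hRT ha)))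
    _ ≤ _ := Nat.le_of_dvd hDpos hdvd

/-- number of nonsmooth terms bound -/
lemma ns_card_bound (n k c : ℕ) (hkn : k < n)
    (h : k.factorial < (n - k) ^ (k + 1 - c - Nat.primeCounting k)) : c < (nsSet n k).card := by
  by_contra hcon
  push Not at hcon
  have h1 := erdos_count (k + 1) 1 k (n - k) (fun a => n - a) one_pos (by omega)
    (fun a ha => by omega) (fun a ha b hb => by unfold dst; omega)
    (Finset.range (k + 1) \ nsSet n k) Finset.sdiff_subset
    (by
      intro a ha p hp hpa
      rw [Finset.mem_sdiff, mem_nsSet, Finset.mem_range] at ha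
      by_contra hpk
      exact ha.2 ⟨by omega, p, hp, by omega, hpa⟩)
  rw [Finset.card_sdiff_of_subset (by intro l hl; exact Finset.mem_range.2 (by have := (mem_nsSet.1 hl).1; omega)), Finset.card_range, one_pow, one_mul,
    Nat.add_sub_cancel] at h1
  have h2 := Nat.pow_le_pow_right (show 0 < n - k by omega)
    (show k + 1 - c - Nat.primeCounting k ≤ k + 1 - (nsSet n k).card - Nat.primeCounting k by omega)
  omega

lemma ns_odd_bound (n k h : ℕ) (hkh : k = 2 * h) (hkn : k < n)
    (hh : 2 ^ (h - 1) * (h - 1).factorial < (n - k) ^ (h - 1 - Nat.primeCounting k)) :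
    2 ≤ ((nsSet n k).filter (fun l => l % 2 = 1)).card := by
  by_contra hcon
  set S := (nsSet n k).filter (fun l => l % 2 = 1)
  set S' := S.image (fun l => l / 2)
  have hc' : S'.card ≤ 1 := le_trans Finset.card_image_le (by omega)
  have h1 := erdos_count h 2 k (n - k) (fun a => n - (2 * a + 1)) two_pos (by omega)
    (fun a ha => by omega) (fun a ha b hb => by unfold dst; omega)
    (Finset.range h \ S') Finset.sdiff_subset
    (by
      intro a ha p hp hpa
      rw [Finset.mem_sdiff, Finset.mem_range] at ha
      by_contra hpk
      apply ha.2
      refine Finset.mem_image.2 ⟨2 * a + 1, Finset.mem_filter.2 ⟨mem_nsSet.2 ⟨by omega, p, hp,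
        by omega, hpa⟩, by omega⟩, by omega⟩)
  have h3 := Finset.le_card_sdiff S' (Finset.range h)
  rw [Finset.card_range] at h3
  have h2 := Nat.pow_le_pow_right (show 0 < n - k by omega)
    (show h - 1 - Nat.primeCounting k ≤ (Finset.range h \ S').card - Nat.primeCounting k by omega)
  omega

lemma irr_of_N3 (n k : ℕ) (hk : 1 ≤ k) (hkn : k < n) (hn2 : n < (k + 1) ^ 2)
    (h : k.factorial < (n - k) ^ (k - 1 - Nat.primeCounting k)) : Irreducible (P n k) :=
  irr_of_card_three n k hk hkn hn2 (ns_card_bound n k 2 hkn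
    (by rwa [show k + 1 - 2 = k - 1 by omega]))

lemma irr_of_N5 (n k : ℕ) (hk : 1 ≤ k) (hkn : k < n) (hn3 : n < (k + 1) ^ 3)
    (h : k.factorial < (n - k) ^ (k - 3 - Nat.primeCounting k))
    (hh : k % 2 = 0 → 2 ^ (k / 2 - 1) * (k / 2 - 1).factorial <
      (n - k) ^ (k / 2 - 1 - Nat.primeCounting k)) : Irreducible (P n k) :=
  irr_of_card_five n k hk hkn hn3 (ns_card_bound n k 4 hkn
    (by rwa [show k + 1 - 4 = k - 3 by omega]))
    (fun he => ns_odd_bound n k (k / 2) (by omega) hkn (hh he))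


/-- test on the cofactor -/
def cofTest (F m : ℕ) : Bool :=
  Nat.rec false (fun m' _ => Bool.and (Nat.blt 0 m')
    (Bool.and (Nat.beq (Nat.gcd (m' + 1) F) 1) (Bool.not (Nat.beq ((m' + 1) % 24) 1)))) m

/-- Boolean goodness test -/
def goodb (F g : ℕ) : Bool := cofTest F (g / Nat.gcd g F)

/-- search upwards -/
def findUp (F : ℕ) (fuel : ℕ) : ℕ → ℕ :=
  Nat.rec (fun _ => 0) (fun _ ih g => bif goodb F g then g else ih (g + 1)) fuel

/-- chain of good numbers -/
def chain (F k s lim : ℕ) (fuel : ℕ) : ℕ → ℕ → ℕ → Bool :=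
  Nat.rec (fun _ _ _ => false) (fun _ ih a b c =>
    bif Nat.ble lim (a + k) then true else
      Nat.rec false (fun d' _ =>
        bif Nat.ble d' (a + k) then ih b c (d' + 1) else
          Nat.rec false (fun d' _ => bif Nat.ble d' (a + k) then ih b c (d' + 1) else false)
            (findUp F k (c + 1)))
        (findUp F k (c + s))) fuel

/-- full check for one k -/
def chainAll (lim k s : ℕ) : Bool :=
  Nat.rec false (fun F' _ =>
    Nat.rec false (fun a _ =>
      Nat.rec false (fun b _ =>
        Nat.rec false (fun c _ =>
          bif Nat.ble (c + 1) (2 * k) then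
            chain (F' + 1) k s lim 5000 (a + 1) (b + 1) (c + 1)
          else false) (findUp (F' + 1) k (b + 2))) (findUp (F' + 1) k (a + 2)))
      (findUp (F' + 1) k k)) (k.factorial ^ 4)

/-- range of checks -/
def chainRange (lim : ℕ → ℕ) (k0 : ℕ) (m : ℕ) : Bool :=
  Nat.rec true (fun i ih => bif chainAll (lim (k0 + i)) (k0 + i) ((k0 + i) / 4) then ih else false) m

lemma findUp_spec (F fuel g r : ℕ) (h : findUp F fuel g = r) :
    r = 0 ∨ (g ≤ r ∧ goodb F r = true) := by
  induction fuel generalizing g with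
  | zero => left; exact h.symm
  | succ f ih =>
    have h' : (bif goodb F g then g else findUp F f (g + 1)) = r := h
    cases hg : goodb F g with
    | true =>
      rw [hg, cond_true] at h'
      subst h'
      exact Or.inr ⟨le_rfl, hg⟩
    | false =>
      rw [hg, cond_false] at h'
      rcases ih _ h' with h1 | h1
      · exact Or.inl h1
      · exact Or.inr ⟨by omega, h1.2⟩

/-- three good numbers in a window -/
def Win (F k x : ℕ) : Prop := ∃ u v w, x ≤ u ∧ u < v ∧ v < w ∧ w ≤ x + k ∧ goodb F u = true ∧
  goodb F v = true ∧ goodb F w = true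

lemma chain_spec (F k s lim : ℕ) (hs : 1 ≤ s) (fuel a b c : ℕ)
    (h : chain F k s lim fuel a b c = true)
    (hab : a < b) (hbc : b < c) (gb : goodb F b = true) (gc : goodb F c = true) :
    ∀ x, a < x → x + k < lim → Win F k x := by
  induction fuel generalizing a b c with
  | zero => exact Bool.noConfusion (show false = true from h)
  | succ f ih =>
    intro x hax hxl
    have h' : (bif Nat.ble lim (a + k) then true else
      Nat.rec false (fun d' _ =>
        bif Nat.ble d' (a + k) then chain F k s lim f b c (d' + 1) else
          Nat.rec false (fun d' _ => bif Nat.ble d' (a + k) then chain F k s lim f b c (d' + 1)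
            else false)
            (findUp F k (c + 1)))
        (findUp F k (c + s)) : Bool) = true := h
    have h1 : Nat.ble lim (a + k) = false := by
      rw [← Bool.not_eq_true, Nat.ble_eq]; omega
    rw [h1, cond_false] at h'
    have step : ∀ d, c < d → d ≤ a + k + 1 → goodb F d = true →
        chain F k s lim f b c d = true → Win F k x := by
      intro d hcd hd gd hch
      by_cases hxb : x ≤ b
      · exact ⟨b, c, d, hxb, hbc, hcd, by omega, gb, gc, gd⟩
      · exact ih b c d hch hbc hcd gc gd x (by omega) hxl
    have second : (Nat.rec false (fun d' _ => bif Nat.ble d' (a + k) then chain F k s lim f b c (d' + 1)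
            else false) (findUp F k (c + 1)) : Bool) = true → Win F k x := by
      intro h2
      rcases hf : findUp F k (c + 1) with _ | d'
      · rw [hf] at h2; exact Bool.noConfusion (show false = true from h2)
      · rw [hf] at h2
        replace h2 : (bif Nat.ble d' (a + k) then chain F k s lim f b c (d' + 1)
            else false) = true := h2
        have h3 := findUp_spec _ _ _ _ hf
        cases hb : Nat.ble d' (a + k) with
        | false => rw [hb] at h2; exact Bool.noConfusion (show false = true from h2)
        | true =>
          rw [hb, cond_true] at h2
          rw [Nat.ble_eq] at hb
          exact step (d' + 1) (by omega) (by omega) (by rcases h3 with h3 | h3; omega; exact h3.2) h2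
    rcases hf : findUp F k (c + s) with _ | d'
    · rw [hf] at h'; exact Bool.noConfusion (show false = true from h')
    · rw [hf] at h'
      replace h' : (bif Nat.ble d' (a + k) then chain F k s lim f b c (d' + 1) else
          Nat.rec false (fun d' _ => bif Nat.ble d' (a + k) then chain F k s lim f b c (d' + 1)
            else false)
            (findUp F k (c + 1)) : Bool) = true := h'
      have h3 := findUp_spec _ _ _ _ hf
      cases hb : Nat.ble d' (a + k) with
      | false =>
        rw [hb, cond_false] at h'
        exact second h'
      | true =>
        rw [hb, cond_true] at h'
        rw [Nat.ble_eq] at hb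
        exact step (d' + 1) (by omega) (by omega) (by rcases h3 with h3 | h3; omega; exact h3.2) h'

lemma rec_elim (x : ℕ) (f : ℕ → Bool) (h : (Nat.rec false (fun n _ => f n) x : Bool) = true) :
    ∃ y, x = y + 1 ∧ f y = true := by
  rcases x with _ | y
  · exact Bool.noConfusion (show false = true from h)
  · exact ⟨y, rfl, h⟩

lemma chainAll_spec (lim k s : ℕ) (hs : 1 ≤ s) (h : chainAll lim k s = true) :
    ∀ x, k ≤ x → x + k < lim → Win (k.factorial ^ 4) k x := by
  intro x hkx hx
  obtain ⟨F', hF, h⟩ := rec_elim _ _ h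
  obtain ⟨a, ha, h⟩ := rec_elim _ _ h
  obtain ⟨b, hb, h⟩ := rec_elim _ _ h
  obtain ⟨c, hc, h⟩ := rec_elim _ _ h
  rw [hF]
  have ha' := findUp_spec _ _ _ _ ha
  have hb' := findUp_spec _ _ _ _ hb
  have hc' := findUp_spec _ _ _ _ hc
  cases hle : Nat.ble (c + 1) (2 * k) with
  | false => rw [hle] at h; exact Bool.noConfusion (show false = true from h)
  | true =>
    rw [hle, cond_true] at h
    rw [Nat.ble_eq] at hle
    by_cases hxa : x ≤ a + 1
    · exact ⟨a + 1, b + 1, c + 1, hxa, by omega, by omega, by omega,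
        by rcases ha' with h3 | h3; omega; exact h3.2, by rcases hb' with h3 | h3; omega; exact h3.2,
        by rcases hc' with h3 | h3; omega; exact h3.2⟩
    · exact chain_spec _ _ _ _ hs _ _ _ _ h (by omega) (by omega)
        (by rcases hb' with h3 | h3; omega; exact h3.2)
        (by rcases hc' with h3 | h3; omega; exact h3.2) x (by omega) hx

lemma chainRange_spec (lim : ℕ → ℕ) (k0 m : ℕ) (h : chainRange lim k0 m = true) :
    ∀ i < m, chainAll (lim (k0 + i)) (k0 + i) ((k0 + i) / 4) = true := by
  induction m with
  | zero => intro i hi; omega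
  | succ m ih =>
    have h' : (bif chainAll (lim (k0 + m)) (k0 + m) ((k0 + m) / 4) then chainRange lim k0 m
      else false) = true := h
    cases hb : chainAll (lim (k0 + m)) (k0 + m) ((k0 + m) / 4) with
    | false => rw [hb] at h'; exact Bool.noConfusion (show false = true from h')
    | true =>
      rw [hb, cond_true] at h'
      intro i hi
      rcases Nat.lt_succ_iff_lt_or_eq.1 hi with h1 | h1
      · exact ih h' i h1
      · rw [h1]; exact hb

lemma goodb_spec (k r g : ℕ) (hr0 : r ≠ 0) (hk : 3 ≤ k) (hg0 : 0 < g) (hg : g < (k + 1) ^ 3)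
    (h : goodb (k.factorial ^ r) g = true) :
    ∃ p, p.Prime ∧ k < p ∧ p ∣ g ∧ ¬ p ^ 2 ∣ g := by
  set F := k.factorial ^ r with hF
  obtain ⟨m', hm, h⟩ := rec_elim _ _ h
  rw [Bool.and_eq_true, Bool.and_eq_true, Nat.beq_eq] at h
  obtain ⟨h1, h2, h3⟩ := h
  have h3' : (m' + 1) % 24 ≠ 1 := by
    intro hh
    rw [hh] at h3
    exact absurd h3 (by decide)
  have h1' : 0 < m' := by
    have : Nat.ble 1 m' = true := h1
    rw [Nat.ble_eq] at this; omega
  rw [← hm] at h2 h3'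
  have hm1 : g / Nat.gcd g F ≠ 1 := by omega
  clear h1 h3 h hm
  set m := g / Nat.gcd g F with hmdef
  have hgm : g = m * Nat.gcd g F := (Nat.div_mul_cancel (Nat.gcd_dvd_left g F)).symm
  have hmpos : 0 < m := Nat.div_pos (Nat.le_of_dvd hg0 (Nat.gcd_dvd_left g F))
    (Nat.gcd_pos_of_pos_left _ hg0)
  have hmg : m ∣ g := ⟨_, hgm⟩
  have hcop : ∀ p, p.Prime → p ∣ m → k < p := by
    intro p hp hpm
    by_contra hpk
    have : p ∣ F := (hp.dvd_factorial.2 (by omega)).trans (dvd_pow_self _ hr0)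
    have := Nat.dvd_gcd hpm this
    rw [h2] at this
    exact hp.one_lt.ne' (Nat.dvd_one.1 this)
  set p := m.minFac
  have hp : p.Prime := Nat.minFac_prime hm1
  have hpm : p ∣ m := Nat.minFac_dvd m
  have hpk := hcop p hp hpm
  refine ⟨p, hp, hpk, hpm.trans hmg, ?_⟩
  intro hp2
  rw [hgm] at hp2
  have hpF : Nat.Coprime p (Nat.gcd g F) := by
    rw [hp.coprime_iff_not_dvd]
    intro hd
    have := hp.dvd_of_dvd_pow (hd.trans (Nat.gcd_dvd_right g F))
    have := hp.dvd_factorial.1 this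
    omega
  have hp2m : p ^ 2 ∣ m := (Nat.Coprime.pow_left 2 hpF).dvd_of_dvd_mul_right hp2
  obtain ⟨t, ht⟩ := hp2m
  have hmle : m ≤ g := Nat.le_of_dvd hg0 hmg
  have htk : t ≤ k := by
    by_contra hcon
    have : (k + 1) ^ 2 * (k + 1) ≤ p ^ 2 * t :=
      Nat.mul_le_mul (Nat.pow_le_pow_left (by omega) 2) (by omega)
    rw [← ht] at this
    have e : (k + 1) ^ 3 = (k + 1) ^ 2 * (k + 1) := by ring
    omega
  have ht1 : t = 1 := by
    by_contra htne
    have hq := Nat.minFac_prime htne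
    have h5 := hcop t.minFac hq ((Nat.minFac_dvd t).trans ⟨p ^ 2, by rw [ht]; ring⟩)
    have h6 : t ≠ 0 := by rintro rfl; simp at ht; omega
    have := Nat.minFac_le (n := t) (by omega)
    omega
  rw [ht1, mul_one] at ht
  have n2 : p % 2 ≠ 0 := fun h => by
    have := (Nat.prime_dvd_prime_iff_eq Nat.prime_two hp).1 (Nat.dvd_of_mod_eq_zero h); omega
  have n3 : p % 3 ≠ 0 := fun h => by
    have := (Nat.prime_dvd_prime_iff_eq Nat.prime_three hp).1 (Nat.dvd_of_mod_eq_zero h); omega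
  apply h3'
  rw [ht, Nat.pow_mod]
  have : p % 24 < 24 := Nat.mod_lt _ (by norm_num)
  have e2 : p % 24 % 2 ≠ 0 := by omega
  have e3 : p % 24 % 3 ≠ 0 := by omega
  generalize p % 24 = q at *
  interval_cases q <;> omega

lemma irr_of_win (n k r : ℕ) (hr : r ≠ 0) (hk : 3 ≤ k) (hkn : 2 * k ≤ n) (hn : n < (k + 1) ^ 3)
    (h : Win (k.factorial ^ r) k (n - k)) : Irreducible (P n k) := by
  obtain ⟨u, v, w, h1, h2, h3, h4, g1, g2, g3⟩ := h
  have key : ∀ u, n - k ≤ u → u ≤ n → goodb (k.factorial ^ r) u = true → Good n k (n - u) := by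
    intro u hu1 hu2 hg
    unfold Good
    rw [show n - (n - u) = u by omega]
    exact goodb_spec k r u hr hk (by omega) (by omega) hg
  exact irr_of_three_good n k (by omega) (by omega) (n - w) (n - v) (n - u) (by omega) (by omega)
    (by omega) (key w (by omega) (by omega) g3) (key v (by omega) (by omega) g2)
    (key u (by omega) (by omega) g1)

/-- limits for the chain -/
def chLim (k : ℕ) : ℕ := bif Nat.ble k 27 then (k + 1) ^ 3 else bif Nat.beq k 32 then 15000 else 7000

lemma chain_check1 : chainRange chLim 10 18 = true := by decide +kernel
lemma chain_check2 : chainRange chLim 28 24 = true := by decide +kernel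

/-- exceptional check -/
def numCheck (k0 : ℕ) (m : ℕ) : Bool :=
  (List.range m).all fun i =>
    let k := k0 + i
    let N := chLim k - k
    decide (k.factorial < N ^ (k - 3 - Nat.primeCounting k)) &&
    (decide (k % 2 = 1) || decide (2 ^ (k / 2 - 1) * (k / 2 - 1).factorial <
      N ^ (k / 2 - 1 - Nat.primeCounting k)))

lemma numCheck_check : numCheck 28 24 = true := by decide +kernel

lemma irr_mid (n k : ℕ) (hk : 10 ≤ k) (hk2 : k < 52) (hkn : 2 * k ≤ n) (hn : n < (k + 1) ^ 3) :
    Irreducible (P n k) := by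
  have hch : chainAll (chLim k) k (k / 4) = true := by
    by_cases h : k < 28
    · have := chainRange_spec _ _ _ chain_check1 (k - 10) (by omega)
      rwa [show 10 + (k - 10) = k by omega] at this
    · have := chainRange_spec _ _ _ chain_check2 (k - 28) (by omega)
      rwa [show 28 + (k - 28) = k by omega] at this
  by_cases hl : n < chLim k
  · exact irr_of_win n k 4 (by norm_num) (by omega) hkn hn (chainAll_spec _ _ _ (by omega) hch (n - k)
      (by omega) (by omega))
  · have hk28 : 28 ≤ k := by
      by_contra h
      have : chLim k = (k + 1) ^ 3 := by
        unfold chLim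
        rw [show Nat.ble k 27 = true by rw [Nat.ble_eq]; omega]
        rfl
      omega
    have h := numCheck_check
    unfold numCheck at h
    rw [List.all_eq_true] at h
    have := h (k - 28) (List.mem_range.2 (by omega))
    simp only [show 28 + (k - 28) = k by omega, Bool.and_eq_true, Bool.or_eq_true,
      decide_eq_true_eq] at this
    obtain ⟨h1, h2⟩ := this
    have hN : chLim k - k ≤ n - k := by omega
    apply irr_of_N5 n k (by omega) (by omega) hn
    · exact h1.trans_le (Nat.pow_le_pow_left hN _)
    · intro he
      rcases h2 with h2 | h2
      · omega
      · exact h2.trans_le (Nat.pow_le_pow_left hN _)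


lemma irr_one (n : ℕ) (hn : 1 ≤ n) : Irreducible (P n 1) := by
  by_contra hred
  obtain ⟨g, h, hgh, d1, d2⟩ := exists_factor n 1 le_rfl hn hred
  omega

lemma irr_two (n : ℕ) (hn : 4 ≤ n) : Irreducible (P n 2) := by
  by_contra hred
  obtain ⟨g, h, hgh, d1, d2⟩ := exists_factor n 2 (by norm_num) (by omega) hred
  have hd : (g.map (Int.castRingHom ℚ)).degree = 1 := by
    rw [degree_map_eq_of_injective Int.cast_injective]
    exact (degree_eq_iff_natDegree_eq_of_pos one_pos).2 (by omega)
  obtain ⟨x, hx⟩ := exists_root_of_degree_eq_one hd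
  have hP : (P n 2).eval x = 0 := by
    rw [← PZ_map, ← hgh, Polynomial.map_mul, eval_mul, hx.eq_zero, zero_mul]
  have hc : ((n.choose 2 : ℕ) : ℚ) = n * (n - 1) / 2 := Nat.cast_choose_two ℚ n
  simp only [P, Finset.sum_range_succ, Finset.sum_range_zero, eval_add, eval_mul, eval_C, eval_pow,
    eval_X, Nat.choose_zero_right, Nat.choose_one_right, hc, eval_zero] at hP
  have h4 : (4:ℚ) ≤ n := by exact_mod_cast hn
  have : ((n:ℚ) * (n - 1) * x + n) ^ 2 + (n * (n - 2)) = 0 := by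
    push_cast at hP
    linear_combination 2 * (n:ℚ) * (n - 1) * hP
  nlinarith [sq_nonneg ((n:ℚ) * (n - 1) * x + n)]

section modq
variable {q : ℕ} [Fact q.Prime]

lemma modq_factor (n k d : ℕ) (hkn : k ≤ n) (hlead : (n.choose k : ZMod q) ≠ 0)
    (g h : ℤ[X]) (hgh : g * h = PZ n k) (hd : g.natDegree = d) :
    ∃ G H : (ZMod q)[X], G * H = (PZ n k).map (Int.castRingHom (ZMod q)) ∧ G.natDegree = d ∧
      G.coeff d = 1 ∧ H.natDegree ≤ k - d := by
  set φ := Int.castRingHom (ZMod q)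
  have hPd := PZ_natDegree n k hkn
  have hlP : (PZ n k).leadingCoeff = (n.choose k : ℤ) := by
    rw [leadingCoeff, hPd, PZ_coeff, if_pos le_rfl]
  have hlm : g.leadingCoeff * h.leadingCoeff = (n.choose k : ℤ) := by
    rw [← leadingCoeff_mul, hgh, hlP]
  have hlm' : φ g.leadingCoeff * φ h.leadingCoeff ≠ 0 := by
    rw [← map_mul, hlm]
    simpa [φ] using hlead
  have hg0 : φ g.leadingCoeff ≠ 0 := left_ne_zero_of_mul hlm'
  have hgd : (g.map φ).natDegree = d := by rw [natDegree_map_of_leadingCoeff_ne_zero φ hg0, hd]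
  have hgz : g ≠ 0 := by rintro rfl; simp at hg0
  have hhz : h ≠ 0 := by rintro rfl; simp at hlm'
  have hsum : g.natDegree + h.natDegree = k := by rw [← natDegree_mul hgz hhz, hgh, hPd]
  refine ⟨C (φ g.leadingCoeff)⁻¹ * g.map φ, C (φ g.leadingCoeff) * h.map φ, ?_, ?_, ?_, ?_⟩
  · rw [← hgh, Polynomial.map_mul]
    have : (C (φ g.leadingCoeff)⁻¹ * C (φ g.leadingCoeff) : (ZMod q)[X]) = 1 := by
      rw [← C_mul, inv_mul_cancel₀ hg0, C_1]
    linear_combination (g.map φ * h.map φ) * this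
  · rw [natDegree_C_mul (inv_ne_zero hg0), hgd]
  · rw [coeff_C_mul, coeff_map, ← hd]
    exact inv_mul_cancel₀ hg0
  · refine (natDegree_C_mul_le _ _).trans ((natDegree_map_le).trans ?_)
    omega

lemma no_lin (n k : ℕ) (hkn : k ≤ n) (hlead : (n.choose k : ZMod q) ≠ 0)
    (hroot : ∀ x : ZMod q, ∑ j ∈ Finset.range (k + 1), (n.choose j : ZMod q) * x ^ j ≠ 0)
    (g h : ℤ[X]) (hgh : g * h = PZ n k) : g.natDegree ≠ 1 := by
  intro hd
  obtain ⟨G, H, hGH, hG, hG1, -⟩ := modq_factor (q := q) n k 1 hkn hlead g h hgh hd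
  obtain ⟨x, hx⟩ := exists_root_of_degree_eq_one
    ((degree_eq_iff_natDegree_eq_of_pos one_pos).2 hG)
  apply hroot x
  have h1 : eval x (G * H) = 0 := by rw [eval_mul, hx.eq_zero, zero_mul]
  rw [hGH, PZ, Polynomial.map_sum, eval_finsetSum] at h1
  simpa using h1

end modq

lemma irr_lin (n k q : ℕ) [Fact q.Prime] (hk : 1 ≤ k) (hkn : k < n)
    (hlead : (n.choose k : ZMod q) ≠ 0)
    (hroot : ∀ x : ZMod q, ∑ j ∈ Finset.range (k + 1), (n.choose j : ZMod q) * x ^ j ≠ 0)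
    (hd : k = 3 ∨ ∃ p, p.Prime ∧ k < p ∧ p ∣ n - 1 ∧ ¬ p ^ 2 ∣ n - 1) : Irreducible (P n k) := by
  by_contra hred
  obtain ⟨g, h, hgh, d1, d2⟩ := exists_factor n k hk hkn.le hred
  have h1 := no_lin (q := q) n k hkn.le hlead hroot g h hgh
  rcases hd with hd | hd
  · omega
  · have := good_constraint n k 1 hkn hk hd g h hgh d1 d2
    omega

instance fact11 : Fact (Nat.Prime 11) := ⟨by norm_num⟩
instance fact13 : Fact (Nat.Prime 13) := ⟨by norm_num⟩
instance fact19 : Fact (Nat.Prime 19) := ⟨by norm_num⟩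
instance fact29 : Fact (Nat.Prime 29) := ⟨by norm_num⟩
instance fact7 : Fact (Nat.Prime 7) := ⟨by norm_num⟩

lemma irr_6_3 : Irreducible (P 6 3) := irr_lin 6 3 11 (by norm_num) (by norm_num)
  (by decide +kernel) (by decide +kernel) (Or.inl rfl)
lemma irr_9_3 : Irreducible (P 9 3) := irr_lin 9 3 11 (by norm_num) (by norm_num)
  (by decide +kernel) (by decide +kernel) (Or.inl rfl)
lemma irr_12_3 : Irreducible (P 12 3) := irr_lin 12 3 19 (by norm_num) (by norm_num)
  (by decide +kernel) (by decide +kernel) (Or.inl rfl)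
lemma irr_27_3 : Irreducible (P 27 3) := irr_lin 27 3 11 (by norm_num) (by norm_num)
  (by decide +kernel) (by decide +kernel) (Or.inl rfl)
lemma irr_8_4 : Irreducible (P 8 4) := irr_lin 8 4 13 (by norm_num) (by norm_num)
  (by decide +kernel) (by decide +kernel) (Or.inr ⟨7, by norm_num, by norm_num, by norm_num, by norm_num⟩)
lemma irr_100_4 : Irreducible (P 100 4) := irr_lin 100 4 13 (by norm_num) (by norm_num)
  (by decide +kernel) (by decide +kernel) (Or.inr ⟨11, by norm_num, by norm_num, by norm_num, by norm_num⟩)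
lemma irr_12_6 : Irreducible (P 12 6) := irr_lin 12 6 13 (by norm_num) (by norm_num)
  (by decide +kernel) (by decide +kernel) (Or.inr ⟨11, by norm_num, by norm_num, by norm_num, by norm_num⟩)

lemma quad_check : ∀ u v : ZMod 29,
    u * ((45:ZMod 29) - u * (120 - u * (210 - u * 252) - v * 252) - v * (210 - u * 252)) +
      v * (120 - u * (210 - u * 252) - v * 252) = 10 →
    v * ((45:ZMod 29) - u * (120 - u * (210 - u * 252) - v * 252) - v * (210 - u * 252)) = 1 →
    False := by decide +kernel

lemma irr_10_5 : Irreducible (P 10 5) := by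
  by_contra hred
  obtain ⟨g, h, hgh, d1, d2⟩ := exists_factor 10 5 (by norm_num) (by norm_num) hred
  have hd := good_constraint 10 5 3 (by norm_num) (by norm_num)
    ⟨7, by norm_num, by norm_num, by norm_num, by norm_num⟩ g h hgh d1 d2
  obtain ⟨G, H, hGH, hG, hG1, hH⟩ := modq_factor (q := 29) 10 5 2 (by norm_num)
    (by decide +kernel) g h hgh (by omega)
  have zG : ∀ i, 2 < i → G.coeff i = 0 := fun i hi => coeff_eq_zero_of_natDegree_lt (by omega)
  have zH : ∀ i, 3 < i → H.coeff i = 0 := fun i hi => coeff_eq_zero_of_natDegree_lt (by omega)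
  have key : ∀ i, i ≤ 5 → (G * H).coeff i = (Nat.choose 10 i : ZMod 29) := by
    intro i hi
    rw [hGH, coeff_map, PZ_coeff, if_pos hi]; simp
  have k0 := key 0 (by norm_num)
  have k1 := key 1 (by norm_num)
  have k2 := key 2 (by norm_num)
  have k3 := key 3 (by norm_num)
  have k4 := key 4 (by norm_num)
  have k5 := key 5 (by norm_num)
  simp only [coeff_mul, Finset.Nat.sum_antidiagonal_eq_sum_range_succ_mk, Finset.sum_range_succ,
    Finset.sum_range_zero, Nat.reduceSub, Nat.sub_self, Nat.sub_zero, hG1, zG 3 (by norm_num), zG 4 (by norm_num),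
    zG 5 (by norm_num), zH 4 (by norm_num), zH 5 (by norm_num)] at k0 k1 k2 k3 k4 k5
  have c0 : ((Nat.choose 10 0 : ℕ) : ZMod 29) = 1 := by decide +kernel
  have c1 : ((Nat.choose 10 1 : ℕ) : ZMod 29) = 10 := by decide +kernel
  have c2 : ((Nat.choose 10 2 : ℕ) : ZMod 29) = 45 := by decide +kernel
  have c3 : ((Nat.choose 10 3 : ℕ) : ZMod 29) = 120 := by decide +kernel
  have c4 : ((Nat.choose 10 4 : ℕ) : ZMod 29) = 210 := by decide +kernel
  have c5 : ((Nat.choose 10 5 : ℕ) : ZMod 29) = 252 := by decide +kernel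
  rw [c0] at k0
  rw [c1] at k1
  rw [c2] at k2
  rw [c3] at k3
  rw [c4] at k4
  rw [c5] at k5
  have e3 : H.coeff 3 = 252 := by linear_combination k5
  have e2 : H.coeff 2 = 210 - G.coeff 1 * 252 := by rw [← e3]; linear_combination k4
  have e1 : H.coeff 1 = 120 - G.coeff 1 * (210 - G.coeff 1 * 252) - G.coeff 0 * 252 := by
    rw [← e2, ← e3]; linear_combination k3
  have e0 : H.coeff 0 = 45 - G.coeff 1 * (120 - G.coeff 1 * (210 - G.coeff 1 * 252) - G.coeff 0 * 252)
      - G.coeff 0 * (210 - G.coeff 1 * 252) := by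
    rw [← e1, ← e2]; linear_combination k2
  apply quad_check (G.coeff 1) (G.coeff 0)
  · rw [← e0, ← e1]; linear_combination k1
  · rw [← e0]; linear_combination k0

/-- quotient coefficients for the cubic check -/
def cubicBad (u v w : ZMod 7) : Bool :=
  let h5 : ZMod 7 := 12870
  let h4 := 11440 - u * h5
  let h3 := 8008 - u * h4 - v * h5
  let h2 := 4368 - u * h3 - v * h4 - w * h5
  let h1 := 1820 - u * h2 - v * h3 - w * h4
  let h0 := 560 - u * h1 - v * h2 - w * h3
  decide (u * h0 + v * h1 + w * h2 = 120 ∧ v * h0 + w * h1 = 16 ∧ w * h0 = 1)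

lemma cubic_check : ∀ u v w : ZMod 7, cubicBad u v w = false := by decide +kernel

lemma irr_16_8 : Irreducible (P 16 8) := by
  by_contra hred
  obtain ⟨g, h, hgh, d1, d2⟩ := exists_factor 16 8 (by norm_num) (by norm_num) hred
  have hd := good_constraint 16 8 3 (by norm_num) (by norm_num)
    ⟨13, by norm_num, by norm_num, by norm_num, by norm_num⟩ g h hgh d1 d2
  obtain ⟨G, H, hGH, hG, hG1, hH⟩ := modq_factor (q := 7) 16 8 3 (by norm_num)
    (by decide +kernel) g h hgh (by omega)
  have zG : ∀ i, 3 < i → G.coeff i = 0 := fun i hi => coeff_eq_zero_of_natDegree_lt (by omega)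
  have zH : ∀ i, 5 < i → H.coeff i = 0 := fun i hi => coeff_eq_zero_of_natDegree_lt (by omega)
  have key : ∀ i, i ≤ 8 → (G * H).coeff i = (Nat.choose 16 i : ZMod 7) := by
    intro i hi
    rw [hGH, coeff_map, PZ_coeff, if_pos hi]; simp
  have k0 := key 0 (by norm_num)
  have k1 := key 1 (by norm_num)
  have k2 := key 2 (by norm_num)
  have k3 := key 3 (by norm_num)
  have k4 := key 4 (by norm_num)
  have k5 := key 5 (by norm_num)
  have k6 := key 6 (by norm_num)
  have k7 := key 7 (by norm_num)
  have k8 := key 8 (by norm_num)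
  simp only [coeff_mul, Finset.Nat.sum_antidiagonal_eq_sum_range_succ_mk, Finset.sum_range_succ,
    Finset.sum_range_zero, Nat.reduceSub, Nat.sub_self, Nat.sub_zero, hG1, zG 4 (by norm_num),
    zG 5 (by norm_num), zG 6 (by norm_num), zG 7 (by norm_num), zG 8 (by norm_num),
    zH 6 (by norm_num), zH 7 (by norm_num), zH 8 (by norm_num)] at k0 k1 k2 k3 k4 k5 k6 k7 k8
  rw [show ((Nat.choose 16 0 : ℕ) : ZMod 7) = 1 by decide +kernel] at k0
  rw [show ((Nat.choose 16 1 : ℕ) : ZMod 7) = 16 by decide +kernel] at k1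
  rw [show ((Nat.choose 16 2 : ℕ) : ZMod 7) = 120 by decide +kernel] at k2
  rw [show ((Nat.choose 16 3 : ℕ) : ZMod 7) = 560 by decide +kernel] at k3
  rw [show ((Nat.choose 16 4 : ℕ) : ZMod 7) = 1820 by decide +kernel] at k4
  rw [show ((Nat.choose 16 5 : ℕ) : ZMod 7) = 4368 by decide +kernel] at k5
  rw [show ((Nat.choose 16 6 : ℕ) : ZMod 7) = 8008 by decide +kernel] at k6
  rw [show ((Nat.choose 16 7 : ℕ) : ZMod 7) = 11440 by decide +kernel] at k7
  rw [show ((Nat.choose 16 8 : ℕ) : ZMod 7) = 12870 by decide +kernel] at k8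
  have hc := cubic_check (G.coeff 2) (G.coeff 1) (G.coeff 0)
  generalize G.coeff 0 = w at *
  generalize G.coeff 1 = v at *
  generalize G.coeff 2 = u at *
  have e5 : (12870 : ZMod 7) = H.coeff 5 := by linear_combination -k8
  have e4 : (11440 : ZMod 7) - u * H.coeff 5 = H.coeff 4 := by linear_combination -k7
  have e3 : (8008 : ZMod 7) - u * H.coeff 4 - v * H.coeff 5 = H.coeff 3 := by linear_combination -k6
  have e2 : (4368 : ZMod 7) - u * H.coeff 3 - v * H.coeff 4 - w * H.coeff 5 = H.coeff 2 := by
    linear_combination -k5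
  have e1 : (1820 : ZMod 7) - u * H.coeff 2 - v * H.coeff 3 - w * H.coeff 4 = H.coeff 1 := by
    linear_combination -k4
  have e0 : (560 : ZMod 7) - u * H.coeff 1 - v * H.coeff 2 - w * H.coeff 3 = H.coeff 0 := by
    linear_combination -k3
  simp only [cubicBad, e5, e4, e3, e2, e1, e0] at hc
  apply of_decide_eq_false hc
  refine ⟨?_, ?_, ?_⟩
  · linear_combination k2
  · linear_combination k1
  · linear_combination k0

/-- two good indices, or one at the end -/
def pairTest (k n : ℕ) : Bool :=
  (List.range (k + 1)).any fun l₁ => goodb (k.factorial ^ 6) (n - l₁) &&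
    (decide (l₁ = 0) || decide (l₁ = k) || (List.range l₁).any fun l₂ =>
      decide (l₁ + l₂ ≠ k) && goodb (k.factorial ^ 6) (n - l₂))

/-- exceptional pairs -/
def isExc (k n : ℕ) : Bool :=
  (k == 3 && (n == 6 || n == 9 || n == 12 || n == 27)) || (k == 4 && (n == 8 || n == 100)) ||
  (k == 5 && n == 10) || (k == 6 && n == 12) || (k == 8 && n == 16)

/-- all n for one k -/
def pairAll (k : ℕ) : Bool :=
  (List.range ((k + 1) ^ 3 - 2 * k)).all fun i => isExc k (2 * k + i) || pairTest k (2 * k + i)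

lemma pairAll_check : ((List.range 7).all fun i => pairAll (3 + i)) = true := by decide +kernel

lemma irr_of_pairTest (n k : ℕ) (hk : 3 ≤ k) (hkn : 2 * k ≤ n) (hn : n < (k + 1) ^ 3)
    (h : pairTest k n = true) : Irreducible (P n k) := by
  unfold pairTest at h
  rw [List.any_eq_true] at h
  obtain ⟨l₁, hl₁, h⟩ := h
  rw [List.mem_range] at hl₁
  simp only [Bool.and_eq_true, Bool.or_eq_true, decide_eq_true_eq, List.any_eq_true,
    List.mem_range] at h
  obtain ⟨h1, h2⟩ := h
  have g1 : Good n k l₁ := goodb_spec k 6 _ (by norm_num) hk (by omega) (by omega) h1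
  rcases h2 with (h2 | h2) | ⟨l₂, h2, h3, h4⟩
  · exact irr_of_good_end n k (by omega) (by omega) l₁ (Or.inl h2) g1
  · exact irr_of_good_end n k (by omega) (by omega) l₁ (Or.inr h2) g1
  · have g2 : Good n k l₂ := goodb_spec k 6 _ (by norm_num) hk (by omega) (by omega) h4
    exact irr_of_two_good n k (by omega) (by omega) l₁ l₂ (by omega) (by omega) (by omega) h3 g1 g2

lemma irr_small (n k : ℕ) (hk : 1 ≤ k) (hk2 : k < 10) (hkn : 2 * k ≤ n) (hn : n < (k + 1) ^ 3) :
    Irreducible (P n k) := by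
  rcases Nat.lt_or_ge k 3 with h | h
  · interval_cases k
    · exact irr_one n (by omega)
    · exact irr_two n (by omega)
  have h1 := pairAll_check
  rw [List.all_eq_true] at h1
  have h2 := h1 (k - 3) (List.mem_range.2 (by omega))
  rw [show 3 + (k - 3) = k by omega] at h2
  unfold pairAll at h2
  rw [List.all_eq_true] at h2
  have h3 := h2 (n - 2 * k) (List.mem_range.2 (by omega))
  rw [show 2 * k + (n - 2 * k) = n by omega, Bool.or_eq_true] at h3
  rcases h3 with h3 | h3
  · simp only [isExc, Bool.or_eq_true, Bool.and_eq_true, beq_iff_eq] at h3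
    rcases h3 with (((⟨rfl, (((rfl | rfl) | rfl) | rfl)⟩ | ⟨rfl, (rfl | rfl)⟩) | ⟨rfl, rfl⟩) | ⟨rfl, rfl⟩) | ⟨rfl, rfl⟩
    · exact irr_6_3
    · exact irr_9_3
    · exact irr_12_3
    · exact irr_27_3
    · exact irr_8_4
    · exact irr_100_4
    · exact irr_10_5
    · exact irr_12_6
    · exact irr_16_8
  · exact irr_of_pairTest n k h hkn hn h3


/-- one step of the check -/
def chk (k cnt f : ℕ) : Bool :=
  Bool.and (Nat.ble (f + 1) ((2 * k) ^ (k - 1 - cnt))) (Bool.or (Nat.ble k 199) (Nat.ble (4 * cnt + 2) k))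

/-- loop -/
def loopN (M Kend : ℕ) (m : ℕ) : ℕ → ℕ → Bool :=
  Nat.rec (fun _ _ => true) (fun i ih cnt f =>
    bif chk (Kend - (i + 1)) cnt f then
      Nat.rec false (fun f' _ => Nat.rec false (fun c' _ => ih (c' + 1) (f' + 1))
        (bif Nat.beq (Nat.gcd (Kend - i) M) 1 then cnt + 1 else cnt)) (f * (Kend - i))
    else false) m

lemma loop_check : loopN (Nat.factorial 47) 300 248 15 (Nat.factorial 52) = true := by
  decide +kernel

/-- one step of the second check -/
def chk2 (k cnt : ℕ) : Bool :=
  Bool.or (Nat.ble k 299)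
    (Bool.and (Nat.ble (2 * (2 * k) ^ (1 + cnt) + 1) (4 ^ k)) (Nat.ble (4 * cnt + 2) k))

/-- second loop, with a final bound on the count -/
def loopM (M Kend ce : ℕ) (m : ℕ) : ℕ → Bool :=
  Nat.rec (fun cnt => Nat.ble cnt ce) (fun i ih cnt =>
    bif chk2 (Kend - (i + 1)) cnt then
      Nat.rec false (fun c' _ => ih (c' + 1))
        (bif Nat.beq (Nat.gcd (Kend - i) M) 1 then cnt + 1 else cnt)
    else false) m

lemma loop_seg0 : loopM (Nat.factorial 47) 400 78 348 15 = true := by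
  decide +kernel

lemma loop_seg1 : loopM (Nat.factorial 47) 800 139 400 78 = true := by
  decide +kernel

lemma loop_seg2 : loopM (Nat.factorial 47) 1200 196 400 139 = true := by
  decide +kernel

lemma loop_seg3 : loopM (Nat.factorial 47) 1600 251 400 196 = true := by
  decide +kernel

lemma loop_seg4 : loopM (Nat.factorial 47) 2000 303 400 251 = true := by
  decide +kernel

lemma loop_seg5 : loopM (Nat.factorial 47) 2400 357 400 303 = true := by
  decide +kernel

lemma loop_seg6 : loopM (Nat.factorial 47) 2800 407 400 357 = true := by
  decide +kernel

lemma loop_seg7 : loopM (Nat.factorial 47) 3200 454 400 407 = true := by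
  decide +kernel

lemma loop_seg8 : loopM (Nat.factorial 47) 3600 509 400 454 = true := by
  decide +kernel

lemma loop_seg9 : loopM (Nat.factorial 47) 4096 575 496 509 = true := by
  decide +kernel

lemma primeCounting_succ_le (k cnt : ℕ) (hk : 47 ≤ k) (h : Nat.primeCounting k ≤ cnt) :
    Nat.primeCounting (k + 1) ≤
      (bif Nat.beq (Nat.gcd (k + 1) (Nat.factorial 47)) 1 then cnt + 1 else cnt) := by
  rw [Nat.primeCounting, Nat.primeCounting', Nat.count_succ]
  rw [Nat.primeCounting, Nat.primeCounting'] at h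
  by_cases hp : (k + 1).Prime
  · have : Nat.gcd (k + 1) (Nat.factorial 47) = 1 := by
      change Nat.Coprime _ _
      rw [hp.coprime_iff_not_dvd, hp.dvd_factorial]
      omega
    rw [this, if_pos hp]
    change _ ≤ cnt + 1
    omega
  · rw [if_neg hp]
    cases Nat.beq (Nat.gcd (k + 1) (Nat.factorial 47)) 1
    · exact h
    · change _ ≤ cnt + 1
      omega

lemma loop_spec (Kend m cnt f : ℕ) (hm : m + 47 ≤ Kend)
    (h : loopN (Nat.factorial 47) Kend m cnt f = true) (hf : f = (Kend - m).factorial)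
    (hc : Nat.primeCounting (Kend - m) ≤ cnt) :
    ∀ k, Kend - m ≤ k → k < Kend → ∃ c, Nat.primeCounting k ≤ c ∧
      k.factorial < (2 * k) ^ (k - 1 - c) ∧ (200 ≤ k → 4 * c + 2 ≤ k) := by
  induction m generalizing cnt f with
  | zero => intro k h1 h2; omega
  | succ i ih =>
    intro k h1 h2
    have h' : (bif chk (Kend - (i + 1)) cnt f then
      Nat.rec false (fun f' _ => Nat.rec false (fun c' _ =>
          loopN (Nat.factorial 47) Kend i (c' + 1) (f' + 1))
        (bif Nat.beq (Nat.gcd (Kend - i) (Nat.factorial 47)) 1 then cnt + 1 else cnt)) (f * (Kend - i))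
      else false : Bool) = true := h
    cases hchk : chk (Kend - (i + 1)) cnt f with
    | false => rw [hchk] at h'; exact Bool.noConfusion (show false = true from h')
    | true =>
      rw [hchk, cond_true] at h'
      obtain ⟨f', hf', h'⟩ := rec_elim _ _ h'
      obtain ⟨c', hc', h'⟩ := rec_elim _ _ h'
      by_cases hk : k = Kend - (i + 1)
      · subst hk
        unfold chk at hchk
        rw [Bool.and_eq_true, Bool.or_eq_true, Nat.ble_eq, Nat.ble_eq, Nat.ble_eq] at hchk
        refine ⟨cnt, hc, ?_, ?_⟩
        · rw [← hf]; exact hchk.1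
        · intro h200
          rcases hchk.2 with h3 | h3
          · omega
          · exact h3
      · have e : Kend - i = Kend - (i + 1) + 1 := by omega
        refine ih (c' + 1) (f' + 1) (by omega) h' ?_ ?_ k (by omega) h2
        · rw [← hf', hf, e, Nat.factorial_succ, mul_comm]
        · rw [← hc', e]
          exact primeCounting_succ_le _ _ (by omega) hc

lemma loopM_spec (Kend ce m cnt : ℕ) (hm : m + 47 ≤ Kend)
    (h : loopM (Nat.factorial 47) Kend ce m cnt = true)
    (hc : Nat.primeCounting (Kend - m) ≤ cnt) :
    Nat.primeCounting Kend ≤ ce ∧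
    ∀ k, Kend - m ≤ k → k < Kend → 300 ≤ k → ∃ c, Nat.primeCounting k ≤ c ∧
      2 * (2 * k) ^ (1 + c) < 4 ^ k ∧ 4 * c + 2 ≤ k := by
  induction m generalizing cnt with
  | zero =>
    refine ⟨?_, fun k h1 h2 => by omega⟩
    have h' : Nat.ble cnt ce = true := h
    rw [Nat.ble_eq] at h'
    exact hc.trans h'
  | succ i ih =>
    have h' : (bif chk2 (Kend - (i + 1)) cnt then
      Nat.rec false (fun c' _ => loopM (Nat.factorial 47) Kend ce i (c' + 1))
        (bif Nat.beq (Nat.gcd (Kend - i) (Nat.factorial 47)) 1 then cnt + 1 else cnt)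
      else false : Bool) = true := h
    cases hchk : chk2 (Kend - (i + 1)) cnt with
    | false => rw [hchk] at h'; exact Bool.noConfusion (show false = true from h')
    | true =>
      rw [hchk, cond_true] at h'
      obtain ⟨c', hc', h'⟩ := rec_elim _ _ h'
      have e : Kend - i = Kend - (i + 1) + 1 := by omega
      have hrec := ih (c' + 1) (by omega) h' (by
        rw [← hc', e]
        exact primeCounting_succ_le _ _ (by omega) hc)
      refine ⟨hrec.1, fun k h1 h2 h300 => ?_⟩
      by_cases hk : k = Kend - (i + 1)
      · subst hk
        unfold chk2 at hchk
        rw [Bool.or_eq_true, Bool.and_eq_true, Nat.ble_eq, Nat.ble_eq, Nat.ble_eq] at hchk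
        refine ⟨cnt, hc, ?_⟩
        rcases hchk with h3 | h3
        · omega
        · exact ⟨h3.1, h3.2⟩
      · exact hrec.2 k (by omega) h2 h300

lemma two_pow_mul_factorial_le (k : ℕ) : 2 ^ k * k.factorial ≤ (k + 1) ^ k := by
  induction k with
  | zero => simp
  | succ k ih =>
    have hb : 2 * (k + 1) ^ (k + 1) ≤ (k + 2) ^ (k + 1) := by
      have h := one_add_mul_le_pow (a := (1 : ℝ) / (k + 1)) (by
        have : (0:ℝ) ≤ 1 / (k + 1) := by positivity
        linarith) (k + 1)
      have hk : (0:ℝ) < k + 1 := by positivity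
      have e1 : (1:ℝ) + ((k + 1 : ℕ) : ℝ) * (1 / (k + 1)) = 2 := by
        push_cast; field_simp; norm_num
      have e2 : (1:ℝ) + 1 / (k + 1) = (k + 2) / (k + 1) := by field_simp; ring
      rw [e1, e2, div_pow, le_div_iff₀ (by positivity)] at h
      exact_mod_cast h
    calc 2 ^ (k + 1) * (k + 1).factorial = 2 * (k + 1) * (2 ^ k * k.factorial) := by
          rw [Nat.factorial_succ, pow_succ]; ring
      _ ≤ 2 * (k + 1) * (k + 1) ^ k := Nat.mul_le_mul_left _ ih
      _ = 2 * (k + 1) ^ (k + 1) := by rw [pow_succ]; ring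
      _ ≤ (k + 1 + 1) ^ (k + 1) := hb

lemma two_pow_mul_factorial_le' (k : ℕ) (hk : 1 ≤ k) : 2 ^ k * k.factorial ≤ 2 * k ^ k := by
  obtain ⟨m, rfl⟩ : ∃ m, k = m + 1 := ⟨k - 1, by omega⟩
  have := two_pow_mul_factorial_le m
  calc 2 ^ (m + 1) * (m + 1).factorial = 2 * (m + 1) * (2 ^ m * m.factorial) := by
        rw [Nat.factorial_succ, pow_succ]; ring
    _ ≤ 2 * (m + 1) * (m + 1) ^ m := Nat.mul_le_mul_left _ this
    _ = 2 * (m + 1) ^ (m + 1) := by rw [pow_succ]; ring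

lemma fact_lt_of_pow (k c : ℕ) (hk : 1 ≤ k) (hc : 1 + c ≤ k) (h : 2 * (2 * k) ^ (1 + c) < 4 ^ k) :
    k.factorial < (2 * k) ^ (k - 1 - c) := by
  have h1 := two_pow_mul_factorial_le' k hk
  have e : (2 * k) ^ k = (2 * k) ^ (k - 1 - c) * (2 * k) ^ (1 + c) := by
    rw [← pow_add]; congr 1; omega
  have hkk : 0 < k ^ k := by positivity
  have h2 : 2 ^ k * (k.factorial * (2 * k) ^ (1 + c)) < 2 ^ k * ((2 * k) ^ (k - 1 - c) * (2 * k) ^ (1 + c)) := by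
    rw [← e]
    calc 2 ^ k * (k.factorial * (2 * k) ^ (1 + c)) = (2 ^ k * k.factorial) * (2 * k) ^ (1 + c) := by ring
      _ ≤ (2 * k ^ k) * (2 * k) ^ (1 + c) := Nat.mul_le_mul_right _ h1
      _ = k ^ k * (2 * (2 * k) ^ (1 + c)) := by ring
      _ < k ^ k * 4 ^ k := Nat.mul_lt_mul_of_pos_left h hkk
      _ = 2 ^ k * (2 * k) ^ k := by
        rw [show (4:ℕ) = 2 * 2 by norm_num, mul_pow, mul_pow]; ring
  have h3 := Nat.lt_of_mul_lt_mul_left h2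
  exact Nat.lt_of_mul_lt_mul_right h3

lemma loop_mid (k : ℕ) (h1 : 52 ≤ k) (h2 : k < 4096) : ∃ c, Nat.primeCounting k ≤ c ∧
      k.factorial < (2 * k) ^ (k - 1 - c) ∧ (200 ≤ k → 4 * c + 2 ≤ k) := by
  rcases Nat.lt_or_ge k 300 with h | h
  · exact loop_spec 300 248 15 (Nat.factorial 52) (by norm_num) loop_check (by norm_num)
      (by decide +kernel) k h1 h
  have s0 := loopM_spec 400 78 348 15 (by norm_num) loop_seg0 (by decide +kernel)
  have s1 := loopM_spec 800 139 400 78 (by norm_num) loop_seg1 s0.1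
  have s2 := loopM_spec 1200 196 400 139 (by norm_num) loop_seg2 s1.1
  have s3 := loopM_spec 1600 251 400 196 (by norm_num) loop_seg3 s2.1
  have s4 := loopM_spec 2000 303 400 251 (by norm_num) loop_seg4 s3.1
  have s5 := loopM_spec 2400 357 400 303 (by norm_num) loop_seg5 s4.1
  have s6 := loopM_spec 2800 407 400 357 (by norm_num) loop_seg6 s5.1
  have s7 := loopM_spec 3200 454 400 407 (by norm_num) loop_seg7 s6.1
  have s8 := loopM_spec 3600 509 400 454 (by norm_num) loop_seg8 s7.1
  have s9 := loopM_spec 4096 575 496 509 (by norm_num) loop_seg9 s8.1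
  have key : ∃ c, Nat.primeCounting k ≤ c ∧ 2 * (2 * k) ^ (1 + c) < 4 ^ k ∧ 4 * c + 2 ≤ k := by
    rcases Nat.lt_or_ge k 400 with g0 | g0
    · exact s0.2 k (by omega) g0 h
    rcases Nat.lt_or_ge k 800 with g1 | g1
    · exact s1.2 k (by omega) g1 h
    rcases Nat.lt_or_ge k 1200 with g2 | g2
    · exact s2.2 k (by omega) g2 h
    rcases Nat.lt_or_ge k 1600 with g3 | g3
    · exact s3.2 k (by omega) g3 h
    rcases Nat.lt_or_ge k 2000 with g4 | g4
    · exact s4.2 k (by omega) g4 h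
    rcases Nat.lt_or_ge k 2400 with g5 | g5
    · exact s5.2 k (by omega) g5 h
    rcases Nat.lt_or_ge k 2800 with g6 | g6
    · exact s6.2 k (by omega) g6 h
    rcases Nat.lt_or_ge k 3200 with g7 | g7
    · exact s7.2 k (by omega) g7 h
    rcases Nat.lt_or_ge k 3600 with g8 | g8
    · exact s8.2 k (by omega) g8 h
    exact s9.2 k (by omega) h2 h
  obtain ⟨c, hc1, hc2, hc3⟩ := key
  exact ⟨c, hc1, fact_lt_of_pow k c (by omega) (by omega) hc2, fun _ => hc3⟩

/-- numeric check for small k at N = k^2 -/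
def numCheckSq (k0 : ℕ) (m : ℕ) : Bool :=
  (List.range m).all fun i =>
    let k := k0 + i
    let c := Nat.primeCounting k
    decide (k.factorial < (k ^ 2) ^ (k - 3 - c)) &&
    (decide (k % 2 = 1) || decide (2 ^ (k / 2 - 1) * (k / 2 - 1).factorial <
      (k ^ 2) ^ (k / 2 - 1 - c)))

lemma numCheckSq_check : numCheckSq 52 148 = true := by decide +kernel

lemma irr_of_pi_quarter (n k : ℕ) (hk : 10 ≤ k) (hn : (k + 1) ^ 2 ≤ n) (hn3 : n < (k + 1) ^ 3)
    (hpi : 4 * Nat.primeCounting k + 2 ≤ k) : Irreducible (P n k) := by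
  have hN : k ^ 2 < n - k := by
    have : (k + 1) ^ 2 = k ^ 2 + k + k + 1 := by ring
    omega
  have hkn : k < n := by omega
  apply irr_of_N5 n k (by omega) hkn hn3
  · calc k.factorial ≤ k ^ k := Nat.factorial_le_pow k
      _ ≤ k ^ (2 * (k - 3 - Nat.primeCounting k)) := Nat.pow_le_pow_right (by omega) (by omega)
      _ = (k ^ 2) ^ (k - 3 - Nat.primeCounting k) := by rw [pow_mul]
      _ < _ := Nat.pow_lt_pow_left hN (by omega)
  · intro he
    calc 2 ^ (k / 2 - 1) * (k / 2 - 1).factorial ≤ 2 ^ (k / 2 - 1) * (k / 2 - 1) ^ (k / 2 - 1) :=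
          Nat.mul_le_mul_left _ (Nat.factorial_le_pow _)
      _ = (2 * (k / 2 - 1)) ^ (k / 2 - 1) := by rw [mul_pow]
      _ ≤ k ^ (k / 2 - 1) := Nat.pow_le_pow_left (by omega) _
      _ ≤ k ^ (2 * (k / 2 - 1 - Nat.primeCounting k)) := Nat.pow_le_pow_right (by omega) (by omega)
      _ = (k ^ 2) ^ (k / 2 - 1 - Nat.primeCounting k) := by rw [pow_mul]
      _ < _ := Nat.pow_lt_pow_left hN (by omega)

lemma irr_sq_mid (n k : ℕ) (hk : 52 ≤ k) (hk2 : k < 200) (hn : (k + 1) ^ 2 ≤ n)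
    (hn3 : n < (k + 1) ^ 3) : Irreducible (P n k) := by
  have hN : k ^ 2 ≤ n - k := by
    have : (k + 1) ^ 2 = k ^ 2 + k + k + 1 := by ring
    omega
  have h := numCheckSq_check
  unfold numCheckSq at h
  rw [List.all_eq_true] at h
  have := h (k - 52) (List.mem_range.2 (by omega))
  simp only [show 52 + (k - 52) = k by omega, Bool.and_eq_true, Bool.or_eq_true,
    decide_eq_true_eq] at this
  obtain ⟨h1, h2⟩ := this
  apply irr_of_N5 n k (by omega) (by nlinarith) hn3
  · exact h1.trans_le (Nat.pow_le_pow_left hN _)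
  · intro he
    rcases h2 with h2 | h2
    · omega
    · exact h2.trans_le (Nat.pow_le_pow_left hN _)

lemma irr_of_three_primes (n k a b c d : ℕ) (hk : 1 ≤ k) (h1 : n < 3 * k) (h2 : 2 * k ≤ n)
    (ha : a ≤ n - k) (hb : n - k < b) (hbc : b < c) (hcd : c < d) (hd : 2 * d ≤ 3 * a + 1)
    (pb : b.Prime) (pc : c.Prime) (pd : d.Prime) : Irreducible (P n k) := by
  have key : ∀ p, p.Prime → n - k < p → p ≤ n → Good n k (n - p) := by
    intro p hp hp1 hp2
    refine ⟨p, hp, by omega, ?_, ?_⟩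
    · rw [show n - (n - p) = p by omega]
    · rw [show n - (n - p) = p by omega]
      intro h
      have h3 := Nat.le_of_dvd hp.pos h
      have h4 := hp.two_le
      nlinarith
  exact irr_of_three_good n k hk (by omega) (n - d) (n - c) (n - b) (by omega) (by omega) (by omega)
    (key d pd (by omega) (by omega)) (key c pc (by omega) (by omega)) (key b pb hb (by omega))

lemma irr_primes (n k : ℕ) (hk : 52 ≤ k) (hk2 : k < 4096) (h2 : 2 * k ≤ n) (h1 : n < 3 * k) :
    Irreducible (P n k) := by
  rcases Nat.lt_or_ge (n - k) 53 with h | h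
  · exact irr_of_three_primes n k 47 53 59 67 (by omega) h1 h2 (by omega) h (by norm_num)
      (by norm_num) (by norm_num) (by norm_num) (by norm_num) (by norm_num)
  rcases Nat.lt_or_ge (n - k) 59 with h | h
  · exact irr_of_three_primes n k 53 59 67 73 (by omega) h1 h2 (by omega) h (by norm_num)
      (by norm_num) (by norm_num) (by norm_num) (by norm_num) (by norm_num)
  rcases Nat.lt_or_ge (n - k) 67 with h | h
  · exact irr_of_three_primes n k 59 67 73 83 (by omega) h1 h2 (by omega) h (by norm_num)
      (by norm_num) (by norm_num) (by norm_num) (by norm_num) (by norm_num)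
  rcases Nat.lt_or_ge (n - k) 73 with h | h
  · exact irr_of_three_primes n k 67 73 83 97 (by omega) h1 h2 (by omega) h (by norm_num)
      (by norm_num) (by norm_num) (by norm_num) (by norm_num) (by norm_num)
  rcases Nat.lt_or_ge (n - k) 83 with h | h
  · exact irr_of_three_primes n k 73 83 97 109 (by omega) h1 h2 (by omega) h (by norm_num)
      (by norm_num) (by norm_num) (by norm_num) (by norm_num) (by norm_num)
  rcases Nat.lt_or_ge (n - k) 97 with h | h
  · exact irr_of_three_primes n k 83 97 109 113 (by omega) h1 h2 (by omega) h (by norm_num)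
      (by norm_num) (by norm_num) (by norm_num) (by norm_num) (by norm_num)
  rcases Nat.lt_or_ge (n - k) 109 with h | h
  · exact irr_of_three_primes n k 97 109 113 131 (by omega) h1 h2 (by omega) h (by norm_num)
      (by norm_num) (by norm_num) (by norm_num) (by norm_num) (by norm_num)
  rcases Nat.lt_or_ge (n - k) 113 with h | h
  · exact irr_of_three_primes n k 109 113 131 151 (by omega) h1 h2 (by omega) h (by norm_num)
      (by norm_num) (by norm_num) (by norm_num) (by norm_num) (by norm_num)
  rcases Nat.lt_or_ge (n - k) 131 with h | h
  · exact irr_of_three_primes n k 113 131 151 167 (by omega) h1 h2 (by omega) h (by norm_num)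
      (by norm_num) (by norm_num) (by norm_num) (by norm_num) (by norm_num)
  rcases Nat.lt_or_ge (n - k) 151 with h | h
  · exact irr_of_three_primes n k 131 151 167 193 (by omega) h1 h2 (by omega) h (by norm_num)
      (by norm_num) (by norm_num) (by norm_num) (by norm_num) (by norm_num)
  rcases Nat.lt_or_ge (n - k) 167 with h | h
  · exact irr_of_three_primes n k 151 167 193 211 (by omega) h1 h2 (by omega) h (by norm_num)
      (by norm_num) (by norm_num) (by norm_num) (by norm_num) (by norm_num)
  rcases Nat.lt_or_ge (n - k) 193 with h | h
  · exact irr_of_three_primes n k 167 193 211 241 (by omega) h1 h2 (by omega) h (by norm_num)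
      (by norm_num) (by norm_num) (by norm_num) (by norm_num) (by norm_num)
  rcases Nat.lt_or_ge (n - k) 211 with h | h
  · exact irr_of_three_primes n k 193 211 241 277 (by omega) h1 h2 (by omega) h (by norm_num)
      (by norm_num) (by norm_num) (by norm_num) (by norm_num) (by norm_num)
  rcases Nat.lt_or_ge (n - k) 241 with h | h
  · exact irr_of_three_primes n k 211 241 277 317 (by omega) h1 h2 (by omega) h (by norm_num)
      (by norm_num) (by norm_num) (by norm_num) (by norm_num) (by norm_num)
  rcases Nat.lt_or_ge (n - k) 277 with h | h
  · exact irr_of_three_primes n k 241 277 317 359 (by omega) h1 h2 (by omega) h (by norm_num)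
      (by norm_num) (by norm_num) (by norm_num) (by norm_num) (by norm_num)
  rcases Nat.lt_or_ge (n - k) 317 with h | h
  · exact irr_of_three_primes n k 277 317 359 409 (by omega) h1 h2 (by omega) h (by norm_num)
      (by norm_num) (by norm_num) (by norm_num) (by norm_num) (by norm_num)
  rcases Nat.lt_or_ge (n - k) 359 with h | h
  · exact irr_of_three_primes n k 317 359 409 467 (by omega) h1 h2 (by omega) h (by norm_num)
      (by norm_num) (by norm_num) (by norm_num) (by norm_num) (by norm_num)
  rcases Nat.lt_or_ge (n - k) 409 with h | h
  · exact irr_of_three_primes n k 359 409 467 523 (by omega) h1 h2 (by omega) h (by norm_num)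
      (by norm_num) (by norm_num) (by norm_num) (by norm_num) (by norm_num)
  rcases Nat.lt_or_ge (n - k) 467 with h | h
  · exact irr_of_three_primes n k 409 467 523 599 (by omega) h1 h2 (by omega) h (by norm_num)
      (by norm_num) (by norm_num) (by norm_num) (by norm_num) (by norm_num)
  rcases Nat.lt_or_ge (n - k) 523 with h | h
  · exact irr_of_three_primes n k 467 523 599 683 (by omega) h1 h2 (by omega) h (by norm_num)
      (by norm_num) (by norm_num) (by norm_num) (by norm_num) (by norm_num)
  rcases Nat.lt_or_ge (n - k) 599 with h | h
  · exact irr_of_three_primes n k 523 599 683 773 (by omega) h1 h2 (by omega) h (by norm_num)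
      (by norm_num) (by norm_num) (by norm_num) (by norm_num) (by norm_num)
  rcases Nat.lt_or_ge (n - k) 683 with h | h
  · exact irr_of_three_primes n k 599 683 773 883 (by omega) h1 h2 (by omega) h (by norm_num)
      (by norm_num) (by norm_num) (by norm_num) (by norm_num) (by norm_num)
  rcases Nat.lt_or_ge (n - k) 773 with h | h
  · exact irr_of_three_primes n k 683 773 883 1009 (by omega) h1 h2 (by omega) h (by norm_num)
      (by norm_num) (by norm_num) (by norm_num) (by norm_num) (by norm_num)
  rcases Nat.lt_or_ge (n - k) 883 with h | h
  · exact irr_of_three_primes n k 773 883 1009 1153 (by omega) h1 h2 (by omega) h (by norm_num)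
      (by norm_num) (by norm_num) (by norm_num) (by norm_num) (by norm_num)
  rcases Nat.lt_or_ge (n - k) 1009 with h | h
  · exact irr_of_three_primes n k 883 1009 1153 1321 (by omega) h1 h2 (by omega) h (by norm_num)
      (by norm_num) (by norm_num) (by norm_num) (by norm_num) (by norm_num)
  rcases Nat.lt_or_ge (n - k) 1153 with h | h
  · exact irr_of_three_primes n k 1009 1153 1321 1511 (by omega) h1 h2 (by omega) h (by norm_num)
      (by norm_num) (by norm_num) (by norm_num) (by norm_num) (by norm_num)
  rcases Nat.lt_or_ge (n - k) 1321 with h | h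
  · exact irr_of_three_primes n k 1153 1321 1511 1723 (by omega) h1 h2 (by omega) h (by norm_num)
      (by norm_num) (by norm_num) (by norm_num) (by norm_num) (by norm_num)
  rcases Nat.lt_or_ge (n - k) 1511 with h | h
  · exact irr_of_three_primes n k 1321 1511 1723 1973 (by omega) h1 h2 (by omega) h (by norm_num)
      (by norm_num) (by norm_num) (by norm_num) (by norm_num) (by norm_num)
  rcases Nat.lt_or_ge (n - k) 1723 with h | h
  · exact irr_of_three_primes n k 1511 1723 1973 2251 (by omega) h1 h2 (by omega) h (by norm_num)
      (by norm_num) (by norm_num) (by norm_num) (by norm_num) (by norm_num)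
  rcases Nat.lt_or_ge (n - k) 1973 with h | h
  · exact irr_of_three_primes n k 1723 1973 2251 2557 (by omega) h1 h2 (by omega) h (by norm_num)
      (by norm_num) (by norm_num) (by norm_num) (by norm_num) (by norm_num)
  rcases Nat.lt_or_ge (n - k) 2251 with h | h
  · exact irr_of_three_primes n k 1973 2251 2557 2927 (by omega) h1 h2 (by omega) h (by norm_num)
      (by norm_num) (by norm_num) (by norm_num) (by norm_num) (by norm_num)
  rcases Nat.lt_or_ge (n - k) 2557 with h | h
  · exact irr_of_three_primes n k 2251 2557 2927 3347 (by omega) h1 h2 (by omega) h (by norm_num)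
      (by norm_num) (by norm_num) (by norm_num) (by norm_num) (by norm_num)
  rcases Nat.lt_or_ge (n - k) 2927 with h | h
  · exact irr_of_three_primes n k 2557 2927 3347 3833 (by omega) h1 h2 (by omega) h (by norm_num)
      (by norm_num) (by norm_num) (by norm_num) (by norm_num) (by norm_num)
  rcases Nat.lt_or_ge (n - k) 3347 with h | h
  · exact irr_of_three_primes n k 2927 3347 3833 4373 (by omega) h1 h2 (by omega) h (by norm_num)
      (by norm_num) (by norm_num) (by norm_num) (by norm_num) (by norm_num)
  rcases Nat.lt_or_ge (n - k) 3833 with h | h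
  · exact irr_of_three_primes n k 3347 3833 4373 5003 (by omega) h1 h2 (by omega) h (by norm_num)
      (by norm_num) (by norm_num) (by norm_num) (by norm_num) (by norm_num)
  rcases Nat.lt_or_ge (n - k) 4373 with h | h
  · exact irr_of_three_primes n k 3833 4373 5003 5717 (by omega) h1 h2 (by omega) h (by norm_num)
      (by norm_num) (by norm_num) (by norm_num) (by norm_num) (by norm_num)
  rcases Nat.lt_or_ge (n - k) 5003 with h | h
  · exact irr_of_three_primes n k 4373 5003 5717 6529 (by omega) h1 h2 (by omega) h (by norm_num)
      (by norm_num) (by norm_num) (by norm_num) (by norm_num) (by norm_num)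
  rcases Nat.lt_or_ge (n - k) 5717 with h | h
  · exact irr_of_three_primes n k 5003 5717 6529 7459 (by omega) h1 h2 (by omega) h (by norm_num)
      (by norm_num) (by norm_num) (by norm_num) (by norm_num) (by norm_num)
  rcases Nat.lt_or_ge (n - k) 6529 with h | h
  · exact irr_of_three_primes n k 5717 6529 7459 8539 (by omega) h1 h2 (by omega) h (by norm_num)
      (by norm_num) (by norm_num) (by norm_num) (by norm_num) (by norm_num)
  rcases Nat.lt_or_ge (n - k) 7459 with h | h
  · exact irr_of_three_primes n k 6529 7459 8539 9769 (by omega) h1 h2 (by omega) h (by norm_num)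
      (by norm_num) (by norm_num) (by norm_num) (by norm_num) (by norm_num)
  rcases Nat.lt_or_ge (n - k) 8539 with h | h
  · exact irr_of_three_primes n k 7459 8539 9769 11177 (by omega) h1 h2 (by omega) h (by norm_num)
      (by norm_num) (by norm_num) (by norm_num) (by norm_num) (by norm_num)
  omega

lemma irr_upper (n k : ℕ) (hk : 52 ≤ k) (hk2 : k < 4096) (h2 : 2 * k ≤ n) (hn3 : n < (k + 1) ^ 3) :
    Irreducible (P n k) := by
  rcases Nat.lt_or_ge n (3 * k) with h | h
  · exact irr_primes n k hk hk2 h2 h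
  obtain ⟨c, hc1, hc2, hc3⟩ := loop_mid k hk hk2
  rcases Nat.lt_or_ge n ((k + 1) ^ 2) with h' | h'
  · apply irr_of_N3 n k (by omega) (by omega) h'
    calc k.factorial < (2 * k) ^ (k - 1 - c) := hc2
      _ ≤ (2 * k) ^ (k - 1 - Nat.primeCounting k) := Nat.pow_le_pow_right (by omega) (by omega)
      _ ≤ _ := Nat.pow_le_pow_left (by omega) _
  · rcases Nat.lt_or_ge k 200 with h4 | h4
    · exact irr_sq_mid n k hk h4 h' hn3
    · exact irr_of_pi_quarter n k (by omega) h' hn3 (by have := hc3 h4; omega)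


lemma pc_bound6 (s : ℕ) : 3 * Nat.primeCounting s ≤ s + 9 := by
  rcases lt_or_ge s 6 with h | h
  · have : Nat.primeCounting s ≤ 3 := by
      calc Nat.primeCounting s ≤ Nat.primeCounting 5 := Nat.monotone_primeCounting (by omega)
        _ = 3 := by decide +kernel
    omega
  · have h1 := Nat.primeCounting'_add_le (a := 6) (k := 7) (by norm_num) (by norm_num) (s - 6)
    have h2 : Nat.primeCounting' 7 = 3 := by decide +kernel
    have h3 : Nat.totient 6 = 2 := by decide +kernel
    rw [h2, h3, show 7 + (s - 6) = s + 1 by omega] at h1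
    have h4 : Nat.primeCounting s = Nat.primeCounting' (s + 1) := rfl
    omega

lemma pc_bound210 (k : ℕ) (hk : 4096 ≤ k) : 4 * Nat.primeCounting k + 2 ≤ k := by
  have h1 := Nat.primeCounting'_add_le (a := 210) (k := 211) (by norm_num) (by norm_num) (k - 210)
  have h2 : Nat.primeCounting' 211 ≤ 46 := by decide +kernel
  have h3 : Nat.totient 210 = 48 := by decide +kernel
  rw [h3, show 211 + (k - 210) = k + 1 by omega] at h1
  have h4 : Nat.primeCounting k = Nat.primeCounting' (k + 1) := rfl
  omega

/-- The primes exceeding `k` that divide `C(n,k)`. -/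
lemma big_primes_card (n k : ℕ) (hkn : k < n) (hn2 : n < (k + 1) ^ 2)
    (hc : (nsSet n k).card ≤ 2) :
    ((Finset.range (n + 1)).filter (fun p => p.Prime ∧ k < p ∧ p ∣ n.choose k)).card ≤ 2 := by
  refine le_trans ?_ hc
  have key : ∀ p ∈ (Finset.range (n + 1)).filter (fun p => p.Prime ∧ k < p ∧ p ∣ n.choose k),
      ∃ l, l < k ∧ p ∣ n - l := by
    intro p hp
    simp only [Finset.mem_filter, Finset.mem_range] at hp
    obtain ⟨_, hp, hpk, hd⟩ := hp
    have : p ∣ n.descFactorial k := by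
      rw [Nat.descFactorial_eq_factorial_mul_choose]
      exact hd.mul_left _
    rw [Nat.descFactorial_eq_prod_range] at this
    obtain ⟨l, hl, hl2⟩ := (hp.prime.dvd_finsetProd_iff _).1 this
    exact ⟨l, by simpa using hl, hl2⟩
  choose! f hf1 hf2 using key
  refine Finset.card_le_card_of_injOn f ?_ ?_
  · intro p hp
    have hp' := hp
    simp only [Finset.coe_filter, Finset.mem_range, Set.mem_ofPred_eq] at hp'
    rw [Finset.mem_coe, mem_nsSet]
    exact ⟨(hf1 p hp).le, p, hp'.2.1, hp'.2.2.1, hf2 p hp⟩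
  · intro p hp q hq hpq
    have hp' := hp
    have hq' := hq
    simp only [Finset.coe_filter, Finset.mem_range, Set.mem_ofPred_eq] at hp' hq'
    by_contra hne
    have h1 := hf2 p hp
    have h2 := hf2 q hq
    rw [← hpq] at h2
    have h3 : p * q ∣ n - f p :=
      Nat.Coprime.mul_dvd_of_dvd_of_dvd ((Nat.coprime_primes hp'.2.1 hq'.2.1).2 hne) h1 h2
    have h4 := Nat.le_of_dvd (by have := hf1 p hp; omega) h3
    have h5 : (k + 1) * (k + 1) ≤ p * q := Nat.mul_le_mul (by omega) (by omega)
    have : n - f p ≤ n := Nat.sub_le _ _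
    nlinarith

lemma choose_upper (n k m : ℕ) (hkn : k < n) (hn2 : n < (k + 1) ^ 2)
    (hc : (nsSet n k).card ≤ 2)
    (hm : ∀ p, p.Prime → m < p → p ≤ k → Nat.sqrt n < p → (n.choose k).factorization p = 0) :
    n.choose k ≤ n ^ (Nat.primeCounting (Nat.sqrt n) + 2) * 4 ^ m := by
  classical
  set F : ℕ → ℕ := fun p => p ^ (n.choose k).factorization p with hF
  set S := Nat.sqrt n
  set B := (Finset.range (n + 1)).filter (fun p => p.Prime ∧ k < p ∧ p ∣ n.choose k) with hB
  set A := (Finset.range (S + 1)).filter Nat.Prime with hA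
  set M := (Finset.range (m + 1)).filter Nat.Prime with hM
  have h0 : ∏ p ∈ Finset.range (n + 1), F p = n.choose k :=
    Nat.prod_pow_factorization_choose n k hkn.le
  have hn0 : 0 < n := by omega
  have hFn : ∀ p, F p ≤ n := fun p => Nat.pow_factorization_choose_le hn0
  have hF1 : ∀ p, p.Prime → 1 ≤ F p := fun p hp => Nat.one_le_pow _ _ hp.pos
  -- pointwise bound by product of three
  have hpt : ∀ p ∈ Finset.range (n + 1), F p ≤
      (if p ∈ A then n else 1) * (if p ∈ B then n else 1) * (if p ∈ M then p else 1) := by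
    intro p hp
    have hpos : ∀ (c : Prop) [Decidable c] (x : ℕ), 1 ≤ x → 1 ≤ (if c then x else 1) := by
      intro c _ x hx; split_ifs <;> omega
    by_cases hpp : p.Prime
    swap
    · have : F p = 1 := by simp [hF, Nat.factorization_eq_zero_of_not_prime _ hpp]
      rw [this, if_neg (by simp [hA, hpp]), if_neg (by simp [hB, hpp]),
        if_neg (by simp [hM, hpp])]
    have a1 := hpos (p ∈ A) n hn0
    have a2 := hpos (p ∈ B) n hn0
    have a3 := hpos (p ∈ M) p hpp.pos
    by_cases hd : p ∣ n.choose k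
    swap
    · have : F p = 1 := by simp [hF, Nat.factorization_eq_zero_of_not_dvd hd]
      rw [this]
      exact Nat.mul_pos (Nat.mul_pos a1 a2) a3
    by_cases hpA : p ∈ A
    · rw [if_pos hpA]
      calc F p ≤ n := hFn p
        _ ≤ n * _ * _ := by rw [mul_assoc]; exact Nat.le_mul_of_pos_right _ (Nat.mul_pos a2 a3)
    by_cases hpB : p ∈ B
    · rw [if_neg hpA, if_pos hpB, one_mul]
      exact (hFn p).trans (Nat.le_mul_of_pos_right _ a3)
    rw [if_neg hpA, if_neg hpB, one_mul, one_mul]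
    have hSp : S < p := by
      by_contra hh
      exact hpA (by simp only [hA, Finset.mem_filter, Finset.mem_range]; exact ⟨by omega, hpp⟩)
    have hpk : p ≤ k := by
      by_contra hh
      exact hpB (by simp only [hB, Finset.mem_filter]; exact ⟨hp, hpp, by omega, hd⟩)
    by_cases hpM : p ∈ M
    · rw [if_pos hpM]
      have : (n.choose k).factorization p ≤ 1 :=
        Nat.factorization_choose_le_one (Nat.sqrt_lt'.1 hSp)
      calc F p ≤ p ^ 1 := Nat.pow_le_pow_right hpp.pos this
        _ = p := pow_one p
    · have : m < p := by
        by_contra hh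
        exact hpM (by simp only [hM, Finset.mem_filter, Finset.mem_range]; exact ⟨by omega, hpp⟩)
      rw [if_neg hpM]
      simp [hF, hm p hpp this hpk hSp]
  have prodle : ∀ (T : Finset ℕ) (g : ℕ → ℕ), (∀ p ∈ T, 1 ≤ g p) →
      ∏ p ∈ Finset.range (n + 1), (if p ∈ T then g p else 1) ≤ ∏ p ∈ T, g p := by
    intro T g hg
    rw [Finset.prod_ite, Finset.prod_const_one, mul_one]
    refine Finset.prod_le_prod_of_subset_of_one_le' ?_ (fun i hi _ => hg i hi)
    intro x hx
    exact (Finset.mem_filter.1 hx).2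
  have cA : A.card = Nat.primeCounting S := by
    rw [Nat.primeCounting, Nat.primeCounting', Nat.count_eq_card_filter_range]
  have cB : B.card ≤ 2 := big_primes_card n k hkn hn2 hc
  calc n.choose k = ∏ p ∈ Finset.range (n + 1), F p := h0.symm
    _ ≤ ∏ p ∈ Finset.range (n + 1), ((if p ∈ A then n else 1) * (if p ∈ B then n else 1) *
          (if p ∈ M then p else 1)) := Finset.prod_le_prod' hpt
    _ ≤ (∏ p ∈ A, n) * (∏ p ∈ B, n) * ∏ p ∈ M, p := by
        rw [Finset.prod_mul_distrib, Finset.prod_mul_distrib]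
        refine Nat.mul_le_mul (Nat.mul_le_mul (prodle A (fun _ => n) (fun _ _ => hn0))
          (prodle B (fun _ => n) (fun _ _ => hn0))) (prodle M (fun p => p) ?_)
        intro p hp
        exact (Finset.mem_filter.1 hp).2.pos
    _ ≤ n ^ (Nat.primeCounting S + 2) * 4 ^ m := by
        rw [Finset.prod_const, Finset.prod_const, cA, ← pow_add]
        exact Nat.mul_le_mul (Nat.pow_le_pow_right hn0 (by omega)) (primorial_le_four_pow m)

lemma log_bound (t : ℕ) (a b : ℝ) (hb : 0 < b) (t0 : ℝ) (ht0 : t0 ≤ t) (h8 : 8 ≤ t0)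
    (hs : b ^ 2 ≤ t0) (hl : Real.log t0 = a * Real.log 2) (ha : 0 ≤ a) :
    Real.log t ≤ a / b * Real.log 2 * √(t : ℝ) := by
  have he : Real.exp 2 ≤ t0 := by
    have := Real.exp_one_lt_d9
    have h2 : Real.exp 2 = Real.exp 1 * Real.exp 1 := by rw [← Real.exp_add]; norm_num
    have := Real.exp_pos 1
    rw [h2]; nlinarith
  have h := Real.log_div_sqrt_antitoneOn (a := t0) (b := (t : ℝ)) he (he.trans ht0) ht0
  have ht : 0 < √(t : ℝ) := Real.sqrt_pos.2 (by linarith)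
  have hb2 : b ≤ √t0 := Real.le_sqrt_of_sq_le hs
  have hL := Real.log_pos (by norm_num : (1:ℝ) < 2)
  simp only at h
  rw [div_le_iff₀ ht] at h
  refine h.trans ?_
  apply mul_le_mul_of_nonneg_right _ ht.le
  rw [hl, div_mul_eq_mul_div]
  exact div_le_div_of_nonneg_left (by positivity) hb hb2

/-- master inequality -/
lemma irr_of_lower (n k m : ℕ) (hk : 1 ≤ k) (hkn : k < n) (hn2 : n < (k + 1) ^ 2)
    (hm : ∀ p, p.Prime → m < p → p ≤ k → Nat.sqrt n < p → (n.choose k).factorization p = 0)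
    (a b : ℝ) (hb : 0 < b) (t0 : ℝ) (ht0 : t0 ≤ n) (h8 : 8 ≤ t0)
    (hs : b ^ 2 ≤ t0) (hl : Real.log t0 = a * Real.log 2) (ha : 0 ≤ a)
    (E : ℝ) (hE : E * Real.log 2 ≤ Real.log n + Real.log (n.choose k))
    (hfin : (a / b / 3 + 6 * a / b / b) * n + 2 * m < E) : Irreducible (P n k) := by
  by_contra hred
  have hc : (nsSet n k).card ≤ 2 := by
    by_contra hh
    exact hred (irr_of_card_three n k hk hkn hn2 (by omega))
  have hu := choose_upper n k m hkn hn2 hc hm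
  have hL := Real.log_pos (by norm_num : (1:ℝ) < 2)
  have hnpos : (0:ℝ) < n := by linarith
  have hcpos : (0:ℝ) < n.choose k := by exact_mod_cast Nat.choose_pos hkn.le
  have hu' : Real.log (n.choose k) ≤
      ((Nat.primeCounting (Nat.sqrt n) : ℝ) + 2) * Real.log n + m * (2 * Real.log 2) := by
    have : ((n.choose k : ℕ) : ℝ) ≤ (n:ℝ) ^ (Nat.primeCounting (Nat.sqrt n) + 2) * 4 ^ m := by
      exact_mod_cast hu
    have h := Real.log_le_log hcpos this
    rw [Real.log_mul (by positivity) (by positivity), Real.log_pow, Real.log_pow,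
      show (4:ℝ) = 2 ^ 2 by norm_num, Real.log_pow] at h
    push_cast at h
    exact h
  have hlog := log_bound n a b hb t0 ht0 h8 hs hl ha
  set s := √(n:ℝ) with hsdef
  have hs0 : 0 < s := Real.sqrt_pos.2 hnpos
  have hss : s * s = n := Real.mul_self_sqrt hnpos.le
  have hbs : b ≤ s := Real.le_sqrt_of_sq_le (hs.trans ht0)
  have hpi : (Nat.primeCounting (Nat.sqrt n) : ℝ) ≤ s / 3 + 3 := by
    have h1 : (3 : ℝ) * Nat.primeCounting (Nat.sqrt n) ≤ Nat.sqrt n + 9 := by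
      exact_mod_cast pc_bound6 (Nat.sqrt n)
    have h2 : ((Nat.sqrt n : ℕ) : ℝ) ≤ s := Real.nat_sqrt_le_real_sqrt
    linarith
  have hlogn : 0 ≤ Real.log n := Real.log_nonneg (by linarith)
  have h1 : E * Real.log 2 ≤ (s / 3 + 6) * Real.log n + m * (2 * Real.log 2) := by
    have := mul_le_mul_of_nonneg_right hpi hlogn
    nlinarith
  have h2 : (s / 3 + 6) * Real.log n ≤ (a / b / 3 + 6 * a / b / b) * n * Real.log 2 := by
    have h3 : s / 3 + 6 ≤ (1 / 3 + 6 / b) * s := by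
      have : 6 ≤ 6 / b * s := by
        rw [div_mul_eq_mul_div, le_div_iff₀ hb]; linarith
      linarith
    calc (s / 3 + 6) * Real.log n ≤ ((1 / 3 + 6 / b) * s) * (a / b * Real.log 2 * s) :=
          mul_le_mul h3 hlog hlogn (by positivity)
      _ = (a / b / 3 + 6 * a / b / b) * (s * s) * Real.log 2 := by field_simp
      _ = _ := by rw [hss]
  have := mul_lt_mul_of_pos_right hfin hL
  nlinarith

lemma choose_grow (k n0 : ℕ) (c : ℝ) (hc : 0 ≤ c) (h0 : k ≤ n0) (r : ℕ)
    (h : c * ((n0 : ℝ) + r - k) ≤ n0 + r) (hc1 : 1 ≤ c) :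
    c ^ r * (n0.choose k : ℝ) ≤ ((n0 + r).choose k : ℝ) := by
  induction r with
  | zero => simp
  | succ r ih =>
    push_cast at h
    have ih' := ih (by nlinarith)
    have h1 := Nat.choose_mul_succ_eq (n0 + r) k
    have h2 : (((n0 + r).choose k : ℕ) : ℝ) * ((n0:ℝ) + r + 1) =
        ((n0 + (r + 1)).choose k : ℝ) * ((n0:ℝ) + r + 1 - k) := by
      have h3 : ((n0 + r + 1 - k : ℕ) : ℝ) = (n0:ℝ) + r + 1 - k := by
        rw [Nat.cast_sub (by omega)]; push_cast; ring
      rw [← h3]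
      exact_mod_cast h1
    have hk0 : (k:ℝ) ≤ n0 := by exact_mod_cast h0
    have hr : (0:ℝ) ≤ r := Nat.cast_nonneg r
    have hpos : 0 < (n0:ℝ) + r + 1 - k := by linarith
    have hx : (0:ℝ) ≤ ((n0 + r).choose k : ℝ) := Nat.cast_nonneg _
    have h4 : c * ((n0 + r).choose k : ℝ) ≤ ((n0 + (r + 1)).choose k : ℝ) := by
      have : c * ((n0 + r).choose k : ℝ) * ((n0:ℝ) + r + 1 - k) ≤
          ((n0 + (r + 1)).choose k : ℝ) * ((n0:ℝ) + r + 1 - k) := by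
        rw [← h2]
        nlinarith
      exact le_of_mul_le_mul_right this hpos
    calc c ^ (r + 1) * (n0.choose k : ℝ) = c * (c ^ r * (n0.choose k : ℝ)) := by ring
      _ ≤ c * ((n0 + r).choose k : ℝ) := mul_le_mul_of_nonneg_left ih' hc
      _ ≤ _ := h4

lemma lower_base (n k r : ℕ) (c : ℝ) (hc1 : 1 ≤ c) (hk : 4 ≤ k) (hn : 2 * k + r ≤ n)
    (h : c * ((k:ℝ) + r) ≤ 2 * k + r) :
    2 * k * Real.log 2 + r * Real.log c ≤ Real.log n + Real.log (n.choose k) := by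
  have h1 := choose_grow k (2 * k) c (by linarith) (by omega) r (by push_cast; linarith) hc1
  have h2 : (4:ℝ) ^ k ≤ k * ((2 * k).choose k : ℝ) := by
    have := (Nat.four_pow_lt_mul_centralBinom k hk).le
    rw [Nat.centralBinom] at this
    exact_mod_cast this
  have h3 : ((2 * k + r).choose k : ℝ) ≤ n.choose k := by
    exact_mod_cast Nat.choose_le_choose k hn
  have hkn : (k:ℝ) ≤ n := by exact_mod_cast (show k ≤ n by omega)
  have hk0 : (0:ℝ) < k := by exact_mod_cast (show 0 < k by omega)
  have hcc : 0 < c ^ r := by positivity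
  have h4 : (4:ℝ) ^ k * c ^ r ≤ n * n.choose k := by
    calc (4:ℝ) ^ k * c ^ r ≤ k * ((2 * k).choose k : ℝ) * c ^ r :=
          mul_le_mul_of_nonneg_right h2 hcc.le
      _ = k * (c ^ r * ((2 * k).choose k : ℝ)) := by ring
      _ ≤ k * n.choose k := mul_le_mul_of_nonneg_left (h1.trans h3) hk0.le
      _ ≤ _ := mul_le_mul_of_nonneg_right hkn (Nat.cast_nonneg _)
  have h5 := Real.log_le_log (by positivity) h4
  have hcpos : (0:ℝ) < n.choose k := by exact_mod_cast Nat.choose_pos (by omega : k ≤ n)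
  rw [Real.log_mul (by positivity) (by positivity),
    Real.log_mul (by linarith) (by linarith), Real.log_pow, Real.log_pow,
    show (4:ℝ) = 2 ^ 2 by norm_num, Real.log_pow] at h5
  push_cast at h5
  linarith

lemma log_two_pow (t : ℝ) (e : ℕ) (h : t = 2 ^ e) : Real.log t = e * Real.log 2 := by
  rw [h, Real.log_pow]

lemma irr_low (n k : ℕ) (hk : 4096 ≤ k) (h2 : 2 * k ≤ n) (h65 : n ≤ 65 * k) :
    Irreducible (P n k) := by
  have hL := Real.log_pos (by norm_num : (1:ℝ) < 2)
  have hn2 : n < (k + 1) ^ 2 := by nlinarith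
  have hkR : (4096:ℝ) ≤ k := by exact_mod_cast hk
  have htriv : ∀ p, p.Prime → k < p → p ≤ k → Nat.sqrt n < p →
      (n.choose k).factorization p = 0 := fun p _ h1 h2 => by omega
  have hnR : (2:ℝ) * k ≤ n := by exact_mod_cast h2
  rcases le_or_gt (2 * n) (5 * k) with hA | hA
  · have hAR : (2:ℝ) * n ≤ 5 * k := by exact_mod_cast hA
    refine irr_of_lower n k (n / 3) (by omega) (by omega) hn2 ?_ 13 90.5 (by norm_num) 8192
      (by linarith) (by norm_num) (by norm_num) (log_two_pow _ 13 (by norm_num)) (by norm_num)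
      (2 * k) ?_ ?_
    · intro p hp hm hpk hsq
      refine Nat.factorization_choose_of_lt_three_mul ?_ hpk (by omega) (by omega)
      omega
    · have := lower_base n k 0 1 le_rfl (by omega) (by omega) (by push_cast; linarith)
      simpa using this
    · have : ((n / 3 : ℕ) : ℝ) ≤ n / 3 := Nat.cast_div_le
      norm_num
      linarith
  have hAR : (5:ℝ) * k < 2 * n := by exact_mod_cast hA
  rcases le_or_gt n (4 * k) with hB | hB
  · have hBR : (n:ℝ) ≤ 4 * k := by exact_mod_cast hB
    have hr1 : ((k / 2 : ℕ) : ℝ) ≤ k / 2 := Nat.cast_div_le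
    have hr2 : (k:ℝ) ≤ 2 * ((k / 2 : ℕ) : ℝ) + 1 := by exact_mod_cast (show k ≤ 2 * (k / 2) + 1 by omega)
    have hlog : 7 / 12 * Real.log 2 ≤ Real.log (3 / 2) := by
      have h1 : Real.log (2 ^ 7) ≤ Real.log ((3 / 2) ^ 12) :=
        Real.log_le_log (by norm_num) (by norm_num)
      rw [Real.log_pow, Real.log_pow] at h1
      push_cast at h1
      linarith
    refine irr_of_lower n k k (by omega) (by omega) hn2 htriv 13 90.5 (by norm_num) 8192
      (by linarith) (by norm_num) (by norm_num) (log_two_pow _ 13 (by norm_num)) (by norm_num)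
      (2 * k + ((k / 2 : ℕ) : ℝ) * (7 / 12)) ?_ ?_
    · have := lower_base n k (k / 2) (3 / 2) (by norm_num) (by omega) (by omega) (by linarith)
      have := mul_le_mul_of_nonneg_left hlog (Nat.cast_nonneg (α := ℝ) (k / 2))
      linarith
    · norm_num
      linarith
  have hBR : (4:ℝ) * k < n := by exact_mod_cast hB
  rcases le_or_gt n (16 * k) with hC | hC
  · have hCR : (n:ℝ) ≤ 16 * k := by exact_mod_cast hC
    have hlog : 2 / 5 * Real.log 2 ≤ Real.log (4 / 3) := by
      have h1 : Real.log (2 ^ 2) ≤ Real.log ((4 / 3) ^ 5) :=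
        Real.log_le_log (by norm_num) (by norm_num)
      rw [Real.log_pow, Real.log_pow] at h1
      push_cast at h1
      linarith
    refine irr_of_lower n k k (by omega) (by omega) hn2 htriv 14 128 (by norm_num) 16384
      (by linarith) (by norm_num) (by norm_num) (log_two_pow _ 14 (by norm_num)) (by norm_num)
      (2 * k + (2 * k) * (2 / 5)) ?_ ?_
    · have := lower_base n k (2 * k) (4 / 3) (by norm_num) (by omega) (by omega)
        (by push_cast; linarith)
      push_cast at this
      have := mul_le_mul_of_nonneg_left hlog (by positivity : (0:ℝ) ≤ 2 * k)
      linarith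
    · norm_num
      linarith
  have hCR : (16:ℝ) * k < n := by exact_mod_cast hC
  have hDR : (n:ℝ) ≤ 65 * k := by exact_mod_cast h65
  refine irr_of_lower n k k (by omega) (by omega) hn2 htriv 16 256 (by norm_num) 65536
      (by linarith) (by norm_num) (by norm_num) (log_two_pow _ 16 (by norm_num)) (by norm_num)
      (4 * k) ?_ ?_
  · have h1 : (16:ℝ) ^ k ≤ n.choose k := by
      have h2 := Nat.pow_le_choose (α := ℝ) k n
      have h3 : (16 * (k:ℝ)) ^ k ≥ 16 ^ k * k.factorial := by
        rw [mul_pow]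
        gcongr
        exact_mod_cast Nat.factorial_le_pow k
      have h3' := two_pow_mul_factorial_le' k (by omega)
      have h4 : (16:ℝ) ^ k * k.factorial ≤ ((n + 1 - k : ℕ) : ℝ) ^ k := by
        have h5 : (8 * (k:ℝ)) ≤ ((n + 1 - k : ℕ) : ℝ) := by
          exact_mod_cast (show 8 * k ≤ n + 1 - k by omega)
        have h5' : (15 * (k:ℝ)) ≤ ((n + 1 - k : ℕ) : ℝ) := by
          exact_mod_cast (show 15 * k ≤ n + 1 - k by omega)
        have h6 : (2:ℝ) ^ k * k.factorial ≤ 2 * k ^ k := by exact_mod_cast h3'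
        calc (16:ℝ) ^ k * k.factorial = 8 ^ k * (2 ^ k * k.factorial) := by
              rw [← mul_assoc, ← mul_pow]; norm_num
          _ ≤ 8 ^ k * (2 * k ^ k) := by gcongr
          _ ≤ 15 ^ k * k ^ k := by
              rw [← mul_assoc]
              gcongr
              calc (8:ℝ) ^ k * 2 = 8 ^ (k - 1) * 16 := by
                    obtain ⟨j, rfl⟩ : ∃ j, k = j + 1 := ⟨k - 1, by omega⟩
                    simp only [Nat.add_sub_cancel]; ring
                _ ≤ 15 ^ (k - 2) * 15 * 15 := by
                    obtain ⟨j, rfl⟩ : ∃ j, k = j + 2 := ⟨k - 2, by omega⟩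
                    simp only [Nat.add_sub_cancel, show j + 2 - 1 = j + 1 by omega, pow_succ]
                    have : (8:ℝ) ^ j ≤ 15 ^ j := by gcongr; norm_num
                    have h0 : (0:ℝ) ≤ 8 ^ j := by positivity
                    clear * - this h0
                    linarith
                _ = 15 ^ k := by
                    obtain ⟨j, rfl⟩ : ∃ j, k = j + 2 := ⟨k - 2, by omega⟩
                    simp only [Nat.add_sub_cancel]; ring
          _ = (15 * (k:ℝ)) ^ k := by rw [mul_pow]
          _ ≤ _ := by gcongr
      refine le_trans ?_ h2
      rw [le_div_iff₀ (by positivity)]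
      exact h4
    have h5 := Real.log_le_log (by positivity) h1
    rw [Real.log_pow, show (16:ℝ) = 2 ^ 4 by norm_num, Real.log_pow] at h5
    push_cast at h5
    have : 0 ≤ Real.log n := Real.log_nonneg (by linarith)
    linarith
  · norm_num
    linarith

lemma irr_high (n k : ℕ) (hk : 4096 ≤ k) (h65 : 65 * k ≤ n) (hn2 : n < (k + 1) ^ 2) :
    Irreducible (P n k) := by
  refine irr_of_N3 n k (by omega) (by omega) hn2 ?_
  have hL := Real.log_pos (by norm_num : (1:ℝ) < 2)
  have hkR : (4096:ℝ) ≤ k := by exact_mod_cast hk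
  have hq := pc_bound210 k hk
  have hpi := Chebyshev.pi_le_log4_mul_div (x := (k:ℝ)) (by linarith)
  rw [Nat.floor_natCast] at hpi
  set c := Nat.primeCounting k with hc
  have hlog := log_bound k 12 64 (by norm_num) 4096 hkR (by norm_num) (by norm_num)
    (log_two_pow _ 12 (by norm_num)) (by norm_num)
  have hlk : 12 * Real.log 2 ≤ Real.log k := by
    have := Real.log_le_log (by norm_num) hkR
    rwa [log_two_pow 4096 12 (by norm_num)] at this
  rw [Real.log_sqrt (by linarith), show (4:ℝ) = 2 ^ 2 by norm_num, Real.log_pow] at hpi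
  push_cast at hpi
  set s := √(k:ℝ) with hs
  have hss : s * s = k := Real.mul_self_sqrt (by linarith)
  have hs64 : 64 ≤ s := Real.le_sqrt_of_sq_le (by norm_num; linarith)
  set L := Real.log 2
  set K := Real.log k
  have hK0 : 0 < K := by linarith
  -- key bound
  have hmain : (1 + (c:ℝ)) * (K + 6 * L) + L < 7 * k * L := by
    have e1 : 2 * L * k / (K / 2) * (K + 6 * L) ≤ 6 * k * L := by
      rw [div_mul_eq_mul_div, div_le_iff₀ (by positivity)]
      have : 0 ≤ k * L * (K - 12 * L) := by
        apply mul_nonneg (by positivity); linarith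
      nlinarith
    have e2 : (1 + s) * (K + 6 * L) ≤ (65 / 64 * s) * (18 / 64 * L * s) := by
      apply mul_le_mul _ _ (by positivity) (by positivity)
      · linarith
      · have : 64 * L ≤ s * L := mul_le_mul_of_nonneg_right hs64 hL.le
        nlinarith
    have e3 : (65 / 64 * s) * (18 / 64 * L * s) = 65 / 64 * (18 / 64) * k * L := by
      rw [← hss]; ring
    have e4 : (1 + (c:ℝ)) * (K + 6 * L) ≤
        (1 + (2 * L * k / (K / 2) + s)) * (K + 6 * L) :=
      mul_le_mul_of_nonneg_right (by linarith) (by positivity)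
    have e5 : 4096 * L ≤ k * L := mul_le_mul_of_nonneg_right hkR hL.le
    nlinarith
  -- translate
  have h64 : ((64 * k : ℕ) : ℝ) ^ (1 + c) * 2 < 128 ^ k := by
    rw [← Real.log_lt_log_iff (by positivity) (by positivity),
      Real.log_mul (by positivity) (by norm_num), Real.log_pow, Real.log_pow]
    push_cast
    rw [Real.log_mul (by norm_num) (by positivity), log_two_pow 64 6 (by norm_num),
      log_two_pow 128 7 (by norm_num)]
    push_cast
    nlinarith
  have h64n : (64 * k) ^ (1 + c) * 2 < 128 ^ k := by exact_mod_cast h64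
  have hf := two_pow_mul_factorial_le' k (by omega)
  have hN : (64 * k) ^ (k - 1 - c) ≤ (n - k) ^ (k - 1 - c) :=
    Nat.pow_le_pow_left (by omega) _
  refine lt_of_lt_of_le ?_ hN
  by_contra hcon
  push Not at hcon
  have hkpos : 0 < k := by omega
  have g1 : (64 * k) ^ k ≤ k.factorial * (64 * k) ^ (1 + c) := by
    calc (64 * k) ^ k = (64 * k) ^ (k - 1 - c) * (64 * k) ^ (1 + c) := by
          rw [← pow_add]; congr 1; omega
      _ ≤ _ := Nat.mul_le_mul_right _ hcon
  have g2 : 128 ^ k * k ^ k ≤ k ^ k * ((64 * k) ^ (1 + c) * 2) := by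
    calc 128 ^ k * k ^ k = 2 ^ k * (64 * k) ^ k := by
          rw [← mul_pow, ← mul_pow]; congr 1; ring
      _ ≤ 2 ^ k * (k.factorial * (64 * k) ^ (1 + c)) := Nat.mul_le_mul_left _ g1
      _ = (2 ^ k * k.factorial) * (64 * k) ^ (1 + c) := by ring
      _ ≤ (2 * k ^ k) * (64 * k) ^ (1 + c) := Nat.mul_le_mul_right _ hf
      _ = _ := by ring
  have g3 : k ^ k * ((64 * k) ^ (1 + c) * 2) < k ^ k * 128 ^ k :=
    Nat.mul_lt_mul_of_pos_left h64n (by positivity)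
  rw [mul_comm] at g2
  omega

lemma irr_large (n k : ℕ) (hk : 4096 ≤ k) (h2 : 2 * k ≤ n) (hn3 : n < (k + 1) ^ 3) :
    Irreducible (P n k) := by
  rcases le_or_gt ((k + 1) ^ 2) n with h | h
  · exact irr_of_pi_quarter n k (by omega) h hn3 (pc_bound210 k hk)
  rcases le_or_gt n (65 * k) with h' | h'
  · exact irr_low n k hk h2 h'
  · exact irr_high n k hk h'.le h

theorem truncated_binomial_irreducible (n k : ℕ) (hk : 0 < k) (hn : 0 < n) (h1 : 2 ≤ 2 * k) (h2 : 2 * k ≤ n) (h3 : n < (k + 1) ^ 3) : Irreducible (P n k) := by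
  rcases lt_or_ge k 10 with h | h
  · exact irr_small n k hk h h2 h3
  rcases lt_or_ge k 52 with h' | h'
  · exact irr_mid n k h h' h2 h3
  rcases lt_or_ge k 4096 with h'' | h''
  · exact irr_upper n k h' h'' h2 h3
  · exact irr_large n k h'' h2 h3
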